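/- arXiv:1803.04942 — 3 statements merged into one kernel-verified Lean document; each statement's English description precedes it below -/
import Mathlib

section
/- Let L be a finite-dimensional Lie algebra over a field of characteristic zero and let (ξ,h,η) be an sl₂-triple in L. Then ker(ad_η) is contained in the sum of the eigenspaces of ad_h corresponding to non-positive integer eigenvalues: ker(ad_η) ⊆ ⨆_{k∈ℤ, k≤0} ker(ad_h − k·id). -/
open Module in
lemma aux_nilp {K : Type*} [Field K] [CharZero K] {V : Type*} [AddCommGroup V] [Module K V]
    [FiniteDimensional K V] (H E : Module.End K V) (hE : ∀ v, H (E v) = E (H v) + (2 : K) • E v) :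
    ∃ n : ℕ, E ^ n = 0 := by
  by_contra! hc
  have hcomm : ∀ n : ℕ, H * E ^ n - E ^ n * H = (2 * n : K) • E ^ n := by
    intro n
    induction n with
    | zero => simp
    | succ n ih =>
      ext v
      have := LinearMap.congr_fun ih (E v)
      simp only [LinearMap.sub_apply, Module.End.mul_apply, LinearMap.smul_apply, hE, map_add,
        map_smul] at this
      simp only [pow_succ, LinearMap.sub_apply, Module.End.mul_apply, LinearMap.smul_apply]
      push_cast
      rw [sub_eq_iff_eq_add] at this ⊢
      rw [this]
      module
  let T : Module.End K (Module.End K V) := LinearMap.mulLeft K H - LinearMap.mulRight K H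
  have hT : ∀ n : ℕ, T.HasEigenvalue (2 * n : K) := fun n =>
    Module.End.hasEigenvalue_of_hasEigenvector (x := E ^ n)
      ⟨Module.End.mem_eigenspace_iff.2 (by simpa [T] using hcomm n), hc n⟩
  have hinf : (Set.range fun n : ℕ => (2 * n : K)).Infinite :=
    Set.infinite_range_of_injective fun a b hab => by simpa using hab
  exact hinf ((Module.End.finite_hasEigenvalue T).subset (by rintro _ ⟨n, rfl⟩; exact hT n))

lemma aux_comm {K : Type*} [Field K] {V : Type*} [AddCommGroup V] [Module K V]
    (H E F : Module.End K V) (hE : ∀ v, H (E v) = E (H v) + (2 : K) • E v)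
    (hEF : ∀ v, E (F v) = F (E v) + H v) (n : ℕ) : ∀ v,
    F ((E ^ (n + 1)) v) =
      (E ^ (n + 1)) (F v) - (n + 1 : K) • (E ^ n) (H v + (n : K) • v) := by
  induction n with
  | zero => intro v; simp [hEF]
  | succ n ih =>
    intro v
    rw [pow_succ, Module.End.mul_apply, ih (E v), Module.End.mul_apply, hEF]
    simp only [hE, pow_succ, Module.End.mul_apply, map_add, map_smul]
    push_cast
    module

lemma aux_main {K : Type*} [Field K] [CharZero K] {V : Type*} [AddCommGroup V] [Module K V]
    (H E F : Module.End K V) (hE : ∀ v, H (E v) = E (H v) + (2 : K) • E v)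
    (hF : ∀ v, H (F v) = F (H v) - (2 : K) • F v)
    (hEF : ∀ v, E (F v) = F (E v) + H v) (n : ℕ) : ∀ v, F v = 0 → (E ^ n) v = 0 →
    v ∈ ⨆ j : ℕ, ⨆ _ : j < n, LinearMap.ker (H + (j : K) • LinearMap.id) := by
  induction n with
  | zero => intro v _ h; simp_all
  | succ n ih =>
    intro v hv hn
    have h1 := aux_comm H E F hE hEF n v
    rw [hn, hv, map_zero, map_zero, zero_sub, eq_comm, neg_eq_zero, smul_eq_zero] at h1
    have h2 := h1.resolve_left (Nat.cast_add_one_ne_zero n)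
    have h3 : F (H v) = 0 := by have := hF v; simpa [hv] using this.symm
    have h4 := ih _ (by simp [h3, hv]) h2
    have h5 : (⨆ j : ℕ, ⨆ _ : j < n, LinearMap.ker (H + (j : K) • LinearMap.id)) ≤
        (⨆ j : ℕ, ⨆ _ : j < n, LinearMap.ker (H + (j : K) • LinearMap.id)).map
          (H + (n : K) • LinearMap.id) := by
      refine iSup₂_le fun j hj x hx => ?_
      have hne : (n : K) - j ≠ 0 := sub_ne_zero.2 (by exact_mod_cast hj.ne')
      refine ⟨((n : K) - j)⁻¹ • x, Submodule.smul_mem _ _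
        ((le_iSup₂ (f := fun (j : ℕ) (_ : j < n) =>
          LinearMap.ker (H + (j : K) • LinearMap.id)) j hj) hx), ?_⟩
      have hx' : H x = -((j : K) • x) := by
        rw [LinearMap.mem_ker] at hx
        exact eq_neg_of_add_eq_zero_left (by simpa using hx)
      rw [map_smul, inv_smul_eq_iff₀ hne]
      simp only [LinearMap.add_apply, LinearMap.smul_apply, LinearMap.id_apply, hx']
      module
    obtain ⟨u, hu, huv⟩ := h5 h4
    have h6 : v - u ∈ LinearMap.ker (H + (n : K) • LinearMap.id) := by
      rw [LinearMap.mem_ker, map_sub, huv]; simp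
    rw [← sub_add_cancel v u]
    refine Submodule.add_mem _ ((le_iSup₂ (f := fun (j : ℕ) (_ : j < n + 1) =>
          LinearMap.ker (H + (j : K) • LinearMap.id)) n (Nat.lt_succ_self n)) h6) ?_
    revert hu
    apply SetLike.le_def.1
    exact (iSup₂_le fun j hj => le_iSup₂ (f := fun (j : ℕ) (_ : j < n + 1) =>
          LinearMap.ker (H + (j : K) • LinearMap.id)) j (by omega))


/-- Let `L` be a finite-dimensional Lie algebra over a field of characteristic
zero and let `(ξ, h, η)` be an `sl₂`-triple in `L`, i.e. `[h,ξ] = 2ξ`, `[h,η] = -2η` and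
`[ξ,η] = h`.  Then `ker (ad η)` is contained in the sum of the eigenspaces of `ad h`
corresponding to non-positive integer eigenvalues. -/
theorem slTwoTriple_ker_ad_le_iSup_nonpos_eigenspaces
    {K : Type*} [Field K] [CharZero K]
    {L : Type*} [LieRing L] [LieAlgebra K L] [FiniteDimensional K L]
    (ξ h η : L)
    (h₁ : ⁅h, ξ⁆ = (2 : K) • ξ) (h₂ : ⁅h, η⁆ = (-2 : K) • η) (h₃ : ⁅ξ, η⁆ = h) :
    LinearMap.ker (LieAlgebra.ad K L η) ≤
      ⨆ k : ℤ, ⨆ _ : k ≤ 0,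
        LinearMap.ker (LieAlgebra.ad K L h - (k : K) • (LinearMap.id : L →ₗ[K] L)) := by
  have hE : ∀ v, LieAlgebra.ad K L h (LieAlgebra.ad K L ξ v) =
      LieAlgebra.ad K L ξ (LieAlgebra.ad K L h v) + (2 : K) • LieAlgebra.ad K L ξ v := by
    intro v
    simp only [LieAlgebra.ad_apply]
    rw [leibniz_lie h, h₁, smul_lie, add_comm]
  have hF : ∀ v, LieAlgebra.ad K L h (LieAlgebra.ad K L η v) =
      LieAlgebra.ad K L η (LieAlgebra.ad K L h v) - (2 : K) • LieAlgebra.ad K L η v := by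
    intro v
    simp only [LieAlgebra.ad_apply]
    rw [leibniz_lie h, h₂, smul_lie]
    module
  have hEF : ∀ v, LieAlgebra.ad K L ξ (LieAlgebra.ad K L η v) =
      LieAlgebra.ad K L η (LieAlgebra.ad K L ξ v) + LieAlgebra.ad K L h v := by
    intro v
    simp only [LieAlgebra.ad_apply]
    rw [leibniz_lie ξ, h₃, add_comm]
  obtain ⟨n, hn⟩ := aux_nilp _ _ hE
  intro v hv
  have h4 := aux_main _ _ _ hE hF hEF n v hv (by rw [hn]; rfl)
  revert h4
  apply SetLike.le_def.1
  refine iSup₂_le fun j hj => ?_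
  refine le_trans (le_of_eq ?_) (le_iSup₂ (f := fun (k : ℤ) (_ : k ≤ 0) =>
    LinearMap.ker (LieAlgebra.ad K L h - (k : K) • (LinearMap.id : L →ₗ[K] L))) (-(j : ℤ)) (by omega))
  congr 1
  push_cast
  module
end

section
/- Let (ξ,h,η) be the sl₂-triple constructed from the Borel subalgebra 𝔟₊ (ξ = Σ_{α∈Π} e_{−α}, η = Σ_{α∈Π} c_α e_α, h ∈ 𝔥 with α(h) = −2 for all α ∈ Π), and let a ∈ 𝔟₊. Then every element of S(ξ,h,η) + ℂ·a is regular: for all y ∈ ker(ad_η) and all λ ∈ ℂ, the element ξ + y + λ·a is a regular element of 𝔤. Equivalently, S(ξ,h,η) ∩ (𝔤_sing + ℂ·a) = ∅. -/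
open Module

/-- The root space `𝔤_α = {x ∈ 𝔤 : [y, x] = α(y) • x for all y ∈ 𝔥}`. -/
def eigenSpace {L : Type*} [LieRing L] [LieAlgebra ℂ L]
    (H : LieSubalgebra ℂ L) (α : Module.Dual ℂ H) : Submodule ℂ L where
  carrier := {x : L | ∀ y : H, ⁅(y : H), x⁆ = α y • x}
  add_mem' := fun {x} {y} hx hy => by intro z; rw [lie_add, hx z, hy z, smul_add]
  zero_mem' := by intro z; rw [lie_zero, smul_zero]
  smul_mem' := fun c {x} hx => by intro z; rw [lie_smul, hx z, smul_comm]

/-- The set of roots of `𝔤` relative to the Cartan subalgebra `𝔥`. -/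
def rootSet {L : Type*} [LieRing L] [LieAlgebra ℂ L] (H : LieSubalgebra ℂ L) :
    Set (Module.Dual ℂ H) :=
  {α : Module.Dual ℂ H | α ≠ 0 ∧ eigenSpace H α ≠ ⊥}

/-- The Borel subalgebra `𝔟₊ = 𝔥 ⊕ ⨁_{α ∈ Δ₊} 𝔤_α`, as a subspace of `𝔤`. -/
def borelPlus {L : Type*} [LieRing L] [LieAlgebra ℂ L]
    (H : LieSubalgebra ℂ L) (Δp : Finset (Module.Dual ℂ H)) : Submodule ℂ L :=
  H.toSubmodule ⊔ ⨆ α ∈ Δp, eigenSpace H α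


/-- Semicontinuity of the kernel dimension along a line. -/
lemma slice_finite_ker {V : Type*} [AddCommGroup V] [Module ℂ V] [FiniteDimensional ℂ V]
    (A0 A1 : Module.End ℂ V) :
    {t : ℂ | finrank ℂ (LinearMap.ker A0) < finrank ℂ (LinearMap.ker (A0 + t • A1))}.Finite := by
  obtain ⟨W, hW⟩ := Submodule.exists_isCompl (LinearMap.ker A0)
  have hinj : LinearMap.ker (A0.domRestrict W) = ⊥ := by
    rw [LinearMap.ker_eq_bot']
    intro w hw
    have h1 : (w : V) ∈ LinearMap.ker A0 := by simpa using hw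
    have := (Submodule.disjoint_def.1 hW.disjoint) _ h1 w.2
    exact Subtype.ext this
  obtain ⟨g, hg⟩ := LinearMap.exists_leftInverse_of_injective _ hinj
  have hg' : ∀ w : W, g (A0 w) = w := fun w => LinearMap.congr_fun hg w
  let B : Module.End ℂ W := g ∘ₗ (A1.domRestrict W)
  have hfin : {μ : ℂ | B.HasEigenvalue μ}.Finite := by
    exact Module.End.finite_hasEigenvalue B
  have hfin2 : {t : ℂ | B.HasEigenvalue (-t⁻¹)}.Finite :=
    Set.Finite.preimage (f := fun t : ℂ => -t⁻¹)
      (fun a _ b _ hab => by simpa using hab) hfin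
  refine hfin2.subset ?_
  intro t ht
  by_contra hne
  simp only [Set.mem_ofPred_eq] at ht hne
  have hdis : Disjoint (LinearMap.ker (A0 + t • A1)) W := by
    rw [Submodule.disjoint_def]
    intro v hv hvW
    by_contra hv0
    have h1 : A0 v + t • A1 v = 0 := by simpa using hv
    have h2 : (⟨v, hvW⟩ : W) + t • B ⟨v, hvW⟩ = 0 := by
      have := congrArg g h1
      rw [map_add, map_smul, map_zero, hg' ⟨v, hvW⟩] at this
      exact this
    have hw0 : (⟨v, hvW⟩ : W) ≠ 0 := fun h => hv0 (by simpa using h)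
    have ht0 : t ≠ 0 := by
      rintro rfl
      exact hw0 (by simpa using h2)
    apply hne
    refine Module.End.hasEigenvalue_of_hasEigenvector (x := ⟨v, hvW⟩) ⟨?_, hw0⟩
    rw [Module.End.mem_eigenspace_iff]
    have h3 : t • B ⟨v, hvW⟩ = -⟨v, hvW⟩ := by
      rw [eq_neg_iff_add_eq_zero, add_comm]; exact h2
    have h4 := congrArg (fun z => t⁻¹ • z) h3
    simp only [smul_smul, inv_mul_cancel₀ ht0, one_smul] at h4
    rw [h4, smul_neg, neg_smul]
  have e1 := Submodule.finrank_add_finrank_le_of_disjoint hdis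
  have e2 := Submodule.finrank_add_eq_of_isCompl hW
  omega

lemma slice_poly_trace_pow {V : Type*} [AddCommGroup V] [Module ℂ V] [FiniteDimensional ℂ V]
    (A0 A1 : Module.End ℂ V) (k : ℕ) : ∀ C : Module.End ℂ V, ∃ q : Polynomial ℂ, ∀ t : ℂ,
      q.eval t = LinearMap.trace ℂ V ((A0 + t • A1) ^ k * C) := by
  induction k with
  | zero => intro C; exact ⟨Polynomial.C (LinearMap.trace ℂ V C), by simp⟩
  | succ k ih =>
    intro C
    obtain ⟨q0, h0⟩ := ih (A0 * C)
    obtain ⟨q1, h1⟩ := ih (A1 * C)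
    refine ⟨q0 + Polynomial.X * q1, fun t => ?_⟩
    rw [Polynomial.eval_add, Polynomial.eval_mul, Polynomial.eval_X, h0, h1, pow_succ, mul_assoc,
      add_mul, mul_add, map_add, smul_mul_assoc, mul_smul_comm, map_smul, smul_eq_mul]

lemma slice_poly_trace {V : Type*} [AddCommGroup V] [Module ℂ V] [FiniteDimensional ℂ V]
    (A0 A1 : Module.End ℂ V) (p : Polynomial ℂ) (C : Module.End ℂ V) :
    ∃ q : Polynomial ℂ, ∀ t : ℂ,
      q.eval t = LinearMap.trace ℂ V (Polynomial.aeval (A0 + t • A1) p * C) := by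
  induction p using Polynomial.induction_on' with
  | add p q hp hq =>
    obtain ⟨a, ha⟩ := hp
    obtain ⟨b, hb⟩ := hq
    exact ⟨a + b, fun t => by rw [Polynomial.eval_add, ha, hb, map_add, add_mul, map_add]⟩
  | monomial n a =>
    obtain ⟨q, hq⟩ := slice_poly_trace_pow A0 A1 n C
    refine ⟨Polynomial.C a * q, fun t => ?_⟩
    rw [Polynomial.eval_mul, Polynomial.eval_C, hq, Polynomial.aeval_monomial,
      Algebra.algebraMap_eq_smul_one, smul_mul_assoc, one_mul, smul_mul_assoc, map_smul,
      smul_eq_mul]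

/-- The element `g` representing `y ↦ tr (p (ad x) ∘ ad y)` commutes with `x`. -/
lemma slice_grad_mem_ker {L : Type*} [LieRing L] [LieAlgebra ℂ L] [FiniteDimensional ℂ L]
    [LieAlgebra.IsKilling ℂ L] (x : L) (p : Polynomial ℂ) :
    ∃ g ∈ LinearMap.ker (LieAlgebra.ad ℂ L x), ∀ y, killingForm ℂ L g y =
      LinearMap.trace ℂ L (Polynomial.aeval (LieAlgebra.ad ℂ L x) p * LieAlgebra.ad ℂ L y) := by
  let φ : Module.Dual ℂ L := (LinearMap.trace ℂ L) ∘ₗ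
    (LinearMap.mulLeft ℂ (Polynomial.aeval (LieAlgebra.ad ℂ L x) p)) ∘ₗ
      (LieAlgebra.ad ℂ L : L →ₗ[ℂ] Module.End ℂ L)
  have hnd := LieAlgebra.IsKilling.killingForm_nondegenerate ℂ L
  let g := (LinearMap.BilinForm.toDual (killingForm ℂ L) hnd).symm φ
  have hg : ∀ y, killingForm ℂ L g y =
      LinearMap.trace ℂ L (Polynomial.aeval (LieAlgebra.ad ℂ L x) p * LieAlgebra.ad ℂ L y) := by
    intro y
    exact LinearMap.BilinForm.apply_toDual_symm_apply (hB := hnd) φ y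
  refine ⟨g, ?_, hg⟩
  rw [LinearMap.mem_ker, LieAlgebra.ad_apply]
  apply hnd.1
  intro y
  have h1 : killingForm ℂ L ⁅x, g⁆ y = - killingForm ℂ L g ⁅x, y⁆ :=
    LieModule.traceForm_apply_lie_apply' ℂ L L x g y
  have h2 : LieAlgebra.ad ℂ L ⁅x, y⁆ = LieAlgebra.ad ℂ L x * LieAlgebra.ad ℂ L y -
      LieAlgebra.ad ℂ L y * LieAlgebra.ad ℂ L x := by
    ext z; simp
  rw [h1, hg, h2, mul_sub, map_sub, ← mul_assoc, ← mul_assoc,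
    LinearMap.trace_mul_comm ℂ _ (LieAlgebra.ad ℂ L x), ← mul_assoc]
  have hc : Commute (LieAlgebra.ad ℂ L x) (Polynomial.aeval (LieAlgebra.ad ℂ L x) p) := by
    have := Polynomial.aeval_X (R := ℂ) (LieAlgebra.ad ℂ L x)
    nth_rewrite 1 [← this]
    exact (Commute.all Polynomial.X p).map (Polynomial.aeval (LieAlgebra.ad ℂ L x))
  rw [hc.eq]; simp

/-- Every centralizer has dimension at least that of a (split) Cartan subalgebra. -/
lemma slice_finrank_le_ker {L : Type*} [LieRing L] [LieAlgebra ℂ L] [FiniteDimensional ℂ L]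
    [LieAlgebra.IsKilling ℂ L] (H : LieSubalgebra ℂ L) [H.IsCartanSubalgebra]
    (S : Finset (Module.Dual ℂ H)) (hS : ⨆ α ∈ S, eigenSpace H α = ⊤) (x : L) :
    finrank ℂ H ≤ finrank ℂ (LinearMap.ker (LieAlgebra.ad ℂ L x)) := by
  classical
  obtain ⟨h0, hh0⟩ : ∃ h0 : H, ∀ i : {p : S × S // p.1 ≠ p.2},
      ((i.1.1 : Module.Dual ℂ H) - i.1.2) h0 ≠ 0 := by
    apply Module.Dual.exists_forall_ne_zero_of_forall_exists
    intro i
    by_contra hcon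
    push Not at hcon
    exact i.2 (Subtype.ext (sub_eq_zero.1 (LinearMap.ext hcon)))
  have hinj : Set.InjOn (fun α : Module.Dual ℂ H => α h0) S := by
    intro α hα β hβ hab
    by_contra hne
    refine hh0 ⟨(⟨α, hα⟩, ⟨β, hβ⟩), fun h => hne (congrArg Subtype.val h)⟩ ?_
    simpa [sub_eq_zero] using hab
  have hpol : ∀ w : H, ∃ p : Polynomial ℂ,
      Polynomial.aeval (LieAlgebra.ad ℂ L (h0 : L)) p = LieAlgebra.ad ℂ L (w : L) := by
    intro w
    refine ⟨Lagrange.interpolate S (fun α => α h0) (fun α => α w), ?_⟩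
    rw [← sub_eq_zero, ← LinearMap.ker_eq_top, eq_top_iff, ← hS]
    refine iSup₂_le fun α hα v hv => ?_
    have e0 : ⁅(h0 : L), v⁆ = α h0 • v := hv h0
    have e1 : ⁅(w : L), v⁆ = α w • v := hv w
    rw [LinearMap.mem_ker, LinearMap.sub_apply, LieAlgebra.ad_apply, e1]
    by_cases hv0 : v = 0
    · simp [hv0]
    rw [Module.End.aeval_apply_of_hasEigenvector (μ := α h0)
      ⟨Module.End.mem_eigenspace_iff.2 e0, hv0⟩,
      Lagrange.eval_interpolate_at_node (fun α : Module.Dual ℂ H => α w) hinj hα, sub_self]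
  choose p hp using hpol
  let w := Module.finBasis ℂ H
  choose q hq using fun (i j : Fin (finrank ℂ H)) =>
    slice_poly_trace (LieAlgebra.ad ℂ L x) (LieAlgebra.ad ℂ L ((h0 : L) - x)) (p (w i))
      (LieAlgebra.ad ℂ L (w j : L))
  let d : Polynomial ℂ := (Matrix.of q).det
  have hline : ∀ t : ℂ, LieAlgebra.ad ℂ L x + t • LieAlgebra.ad ℂ L ((h0 : L) - x) =
      LieAlgebra.ad ℂ L (x + t • ((h0 : L) - x)) := by
    intro t; rw [map_add, map_smul]
  have hdet : ∀ t, d.eval t = (Matrix.of fun i j => (q i j).eval t).det := by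
    intro t
    have := RingHom.map_det (Polynomial.evalRingHom t) (Matrix.of q)
    exact this
  have hd1 : d.eval 1 ≠ 0 := by
    rw [hdet]
    have hn := LieAlgebra.IsKilling.traceForm_cartan_nondegenerate ℂ L H
    have := (LinearMap.BilinForm.nondegenerate_iff_det_ne_zero w).1 hn
    convert this using 2
    ext i j
    rw [Matrix.of_apply, hq, hline, LinearMap.BilinForm.toMatrix_apply, one_smul, add_sub_cancel, hp]
    rfl
  have hd0 : d ≠ 0 := by rintro h; simp [h] at hd1
  have hfin := slice_finite_ker (LieAlgebra.ad ℂ L x) (LieAlgebra.ad ℂ L ((h0 : L) - x))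
  have hfin2 : {t : ℂ | d.eval t = 0}.Finite := by
    have := Polynomial.finite_setOfPred_isRoot hd0
    exact this
  obtain ⟨t, ht⟩ := (hfin.union hfin2).exists_notMem
  simp only [Set.mem_union, Set.mem_ofPred_eq, not_or, not_lt] at ht
  refine le_trans ?_ ht.1
  rw [hline]
  choose g hgk hg using fun i =>
    slice_grad_mem_ker (x + t • ((h0 : L) - x)) (p (w i))
  have hli : LinearIndependent ℂ (fun i => (⟨g i, hgk i⟩ :
      LinearMap.ker (LieAlgebra.ad ℂ L (x + t • ((h0 : L) - x))))) := by
    let T : LinearMap.ker (LieAlgebra.ad ℂ L (x + t • ((h0 : L) - x))) →ₗ[ℂ]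
        (Fin (finrank ℂ H) → ℂ) :=
      LinearMap.pi (fun j => (killingForm ℂ L).flip (w j : L)) ∘ₗ Submodule.subtype _
    apply LinearIndependent.of_comp T
    have := Matrix.linearIndependent_rows_of_det_ne_zero (A := Matrix.of fun i j => (q i j).eval t)
      (by rw [← hdet]; exact ht.2)
    have key : (T ∘ fun i => (⟨g i, hgk i⟩ :
        LinearMap.ker (LieAlgebra.ad ℂ L (x + t • ((h0 : L) - x))))) =
        (Matrix.of fun i j => (q i j).eval t).row := by
      funext i j
      have e := hg i (w j : L)
      rw [← hline, ← hq] at e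
      exact e
    rw [key]
    exact this
  simpa using hli.fintype_card_le_finrank

/-- The degree `j` part of the grading defined by `h`. -/
@[irreducible] def sliceE {L : Type*} [LieRing L] [LieAlgebra ℂ L] (h : L) (j : ℤ) : Submodule ℂ L :=
  Module.End.eigenspace (LieAlgebra.ad ℂ L h) (-2 * (j : ℂ))

/-- The part of degree in a set `s` of the grading defined by `h`. -/
@[irreducible] def sliceF {L : Type*} [LieRing L] [LieAlgebra ℂ L] (h : L) (s : Set ℤ) : Submodule ℂ L :=
  ⨆ j ∈ s, sliceE h j

section
variable {L : Type*} [LieRing L] [LieAlgebra ℂ L]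

lemma mem_sliceE {h : L} {j : ℤ} {x : L} : x ∈ sliceE h j ↔ ⁅h, x⁆ = (-2 * (j : ℂ)) • x := by
  rw [sliceE, Module.End.mem_eigenspace_iff, LieAlgebra.ad_apply]

lemma sliceE_neg (h : L) (j : ℤ) : sliceE (-h) j = sliceE h (-j) := by
  ext x
  rw [mem_sliceE, mem_sliceE, neg_lie, neg_eq_iff_eq_neg, ← neg_smul]
  push_cast
  rw [show -(-2 * (j : ℂ)) = -2 * -(j : ℂ) by ring]

lemma sliceE_le_sliceF (h : L) {s : Set ℤ} {j : ℤ} (hj : j ∈ s) : sliceE h j ≤ sliceF h s := by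
  unfold sliceF
  exact le_iSup₂_of_le j hj le_rfl

lemma sliceF_le {h : L} {s : Set ℤ} {W : Submodule ℂ L} (hW : ∀ j ∈ s, sliceE h j ≤ W) :
    sliceF h s ≤ W := by
  unfold sliceF
  exact iSup₂_le hW

lemma sliceF_mono (h : L) {s t : Set ℤ} (hst : s ⊆ t) : sliceF h s ≤ sliceF h t :=
  sliceF_le fun _ hj => sliceE_le_sliceF h (hst hj)

lemma sliceF_union_le (h : L) (s t : Set ℤ) : sliceF h (s ∪ t) ≤ sliceF h s ⊔ sliceF h t :=
  sliceF_le fun _ hj => hj.elim (fun hj => (sliceE_le_sliceF h hj).trans le_sup_left)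
    (fun hj => (sliceE_le_sliceF h hj).trans le_sup_right)

lemma sliceE_indep (h : L) : iSupIndep (sliceE h) := by
  unfold sliceE
  exact (Module.End.eigenspaces_iSupIndep (LieAlgebra.ad ℂ L h)).comp
    (f := fun j : ℤ => -2 * (j : ℂ)) (fun a b hab => by simpa using hab)

lemma sliceF_disjoint (h : L) {s t : Set ℤ} (hst : Disjoint s t) :
    Disjoint (sliceF h s) (sliceF h t) := by
  unfold sliceF
  exact (sliceE_indep h).disjoint_biSup_biSup hst

lemma sliceE_lie {h : L} {i j : ℤ} {x y : L} (hx : x ∈ sliceE h i) (hy : y ∈ sliceE h j) :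
    ⁅x, y⁆ ∈ sliceE h (i + j) := by
  rw [mem_sliceE] at *
  rw [leibniz_lie, hx, hy, smul_lie, lie_smul, ← add_smul]
  push_cast; congr 1; ring

lemma sliceF_lie {h : L} {s t u : Set ℤ} (hu : ∀ i ∈ s, ∀ j ∈ t, i + j ∈ u) {x y : L}
    (hx : x ∈ sliceF h s) (hy : y ∈ sliceF h t) : ⁅x, y⁆ ∈ sliceF h u := by
  have h1 : ∀ i ∈ s, ∀ x ∈ sliceE h i, ⁅x, y⁆ ∈ sliceF h u := by
    intro i hi x hx
    have : sliceF h t ≤ (sliceF h u).comap (LieAlgebra.ad ℂ L x) :=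
      sliceF_le fun j hj y hy => sliceE_le_sliceF h (hu i hi j hj) (sliceE_lie hx hy)
    exact this hy
  have : sliceF h s ≤ (sliceF h u).comap (LieAlgebra.ad ℂ L y) := by
    refine sliceF_le fun i hi x hx => ?_
    rw [Submodule.mem_comap, LieAlgebra.ad_apply, ← lie_skew]
    exact neg_mem (h1 i hi x hx)
  have := this hx
  rw [Submodule.mem_comap, LieAlgebra.ad_apply, ← lie_skew] at this
  exact neg_mem_iff.1 this

lemma sliceE_killing {h : L} {i j : ℤ} (hij : i + j ≠ 0) {x y : L} (hx : x ∈ sliceE h i)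
    (hy : y ∈ sliceE h j) : killingForm ℂ L x y = 0 := by
  rw [mem_sliceE] at *
  have h1 : killingForm ℂ L ⁅h, x⁆ y = - killingForm ℂ L x ⁅h, y⁆ :=
    LieModule.traceForm_apply_lie_apply' ℂ L L h x y
  rw [hx, hy, map_smul, map_smul, LinearMap.smul_apply, smul_eq_mul, smul_eq_mul] at h1
  have h2 : ((i + j : ℤ) : ℂ) * killingForm ℂ L x y = 0 := by
    push_cast
    linear_combination (-1/2 : ℂ) * h1
  rcases mul_eq_zero.1 h2 with h3 | h3
  · exact absurd (by exact_mod_cast h3) hij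
  · exact h3

lemma sliceF_killing {h : L} {s t : Set ℤ} (hst : ∀ i ∈ s, ∀ j ∈ t, i + j ≠ 0) {x y : L}
    (hx : x ∈ sliceF h s) (hy : y ∈ sliceF h t) : killingForm ℂ L x y = 0 := by
  have h1 : ∀ i ∈ s, ∀ x ∈ sliceE h i, killingForm ℂ L x y = 0 := by
    intro i hi x hx
    have : sliceF h t ≤ LinearMap.ker (killingForm ℂ L x) :=
      sliceF_le fun j hj y hy => sliceE_killing (hst i hi j hj) hx hy
    exact this hy
  have : sliceF h s ≤ LinearMap.ker ((killingForm ℂ L).flip y) :=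
    sliceF_le fun i hi x hx => h1 i hi x hx
  exact this hx

/-- Lowest-component argument: `ad (e + b)` is injective on positive degrees. -/
lemma slice_injective [FiniteDimensional ℂ L] {h e f : L} (t : IsSl2Triple h e f) {b : L}
    (hb : b ∈ sliceF h (Set.Ici 0)) {z : L} (hz : z ∈ sliceF h (Set.Ici 1))
    (hez : ⁅e + b, z⁆ = 0) : z = 0 := by
  have he : e ∈ sliceE h (-1) := by
    rw [mem_sliceE, t.lie_h_e_smul ℂ]; norm_num
  have step : ∀ k : ℕ, z ∈ sliceF h (Set.Ici ((k : ℤ) + 1)) := by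
    intro k
    induction k with
    | zero => simpa using hz
    | succ k ih =>
      have hle : sliceF h (Set.Ici ((k : ℤ) + 1)) ≤
          sliceE h ((k : ℤ) + 1) ⊔ sliceF h (Set.Ici ((k : ℤ) + 2)) := by
        refine sliceF_le fun j hj => ?_
        rcases eq_or_lt_of_le (Set.mem_Ici.1 hj) with h1 | h1
        · rw [← h1]; exact le_sup_left
        · exact (sliceE_le_sliceF h (Set.mem_Ici.2 (by omega))).trans le_sup_right
      obtain ⟨u, hu, v, hv, rfl⟩ := Submodule.mem_sup.1 (hle ih)
      have e1 : ⁅e, u⁆ ∈ sliceF h {(k : ℤ)} := by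
        have := sliceE_lie he hu
        refine sliceE_le_sliceF h ?_ this
        simp
      have e2 : ⁅e, v⁆ ∈ sliceF h (Set.Ici ((k : ℤ) + 1)) :=
        sliceF_lie (s := {-1}) (by
          intro i hi j hj
          simp only [Set.mem_singleton_iff, Set.mem_Ici] at *
          omega) (sliceE_le_sliceF h (Set.mem_singleton _) he) hv
      have e3 : ⁅b, u + v⁆ ∈ sliceF h (Set.Ici ((k : ℤ) + 1)) :=
        sliceF_lie (by
          intro i hi j hj
          simp only [Set.mem_Ici] at *
          omega) hb ih
      have e4 : ⁅e, u⁆ = 0 := by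
        refine Submodule.disjoint_def.1 (sliceF_disjoint h (s := {(k : ℤ)})
          (t := Set.Ici ((k : ℤ) + 1)) (by simp)) _ e1 ?_
        have : ⁅e, u⁆ = -(⁅e, v⁆ + ⁅b, u + v⁆) := by
          rw [add_lie, lie_add] at hez
          rw [eq_neg_iff_add_eq_zero, ← hez]; abel
        rw [this]
        exact neg_mem (add_mem e2 e3)
      have hu0 : u = 0 := by
        by_contra hne
        have P : t.HasPrimitiveVectorWith u (-2 * (((k : ℤ) + 1 : ℤ) : ℂ)) :=
          ⟨hne, mem_sliceE.1 hu, e4⟩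
        obtain ⟨n, hn⟩ := P.exists_nat
        have : (-2 * ((k : ℤ) + 1) : ℤ) = (n : ℤ) := by exact_mod_cast hn
        omega
      rw [hu0, zero_add]
      convert hv using 3
      push_cast; ring
  have hfin : {j : ℤ | (LieAlgebra.ad ℂ L h).HasEigenvalue (-2 * (j : ℂ))}.Finite :=
    Set.Finite.preimage (f := fun j : ℤ => -2 * (j : ℂ))
      (fun a _ b _ hab => by simpa using hab) (LieAlgebra.ad ℂ L h).finite_hasEigenvalue
  obtain ⟨N, hN⟩ := hfin.bddAbove
  have hbot : sliceF h (Set.Ici ((N.toNat : ℤ) + 1)) = ⊥ := by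
    rw [eq_bot_iff]
    refine sliceF_le fun j hj => ?_
    by_contra hne
    have hev : (LieAlgebra.ad ℂ L h).HasEigenvalue (-2 * (j : ℂ)) := by
      rw [Module.End.hasEigenvalue_iff]
      intro h0
      exact hne (by rw [sliceE, h0])
    have := hN hev
    have := Set.mem_Ici.1 hj
    omega
  have := step N.toNat
  rw [hbot] at this
  simpa using this

lemma slice_ker_f_le [FiniteDimensional ℂ L] {h e f : L} (t : IsSl2Triple h e f)
    (htop : sliceF h Set.univ = ⊤) {y : L} (hy : ⁅f, y⁆ = 0) : y ∈ sliceF h (Set.Ici 0) := by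
  have hf : f ∈ sliceE h 1 := by
    rw [mem_sliceE, t.lie_lie_smul_f ℂ]; simp
  have h1 : y ∈ sliceF h (Set.Iio 0 ∪ Set.Ici 0) := by
    rw [Set.Iio_union_Ici, htop]; trivial
  obtain ⟨u, hu, v, hv, rfl⟩ := Submodule.mem_sup.1 (sliceF_union_le h _ _ h1)
  have e1 : ⁅f, u⁆ ∈ sliceF h (Set.Iic 0) := sliceF_lie (s := {1}) (by
      intro i hi j hj
      simp only [Set.mem_singleton_iff, Set.mem_Iic, Set.mem_Iio] at *
      omega) (sliceE_le_sliceF h (Set.mem_singleton _) hf) hu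
  have e2 : ⁅f, v⁆ ∈ sliceF h (Set.Ioi 0) := sliceF_lie (s := {1}) (by
      intro i hi j hj
      simp only [Set.mem_singleton_iff, Set.mem_Ici, Set.mem_Ioi] at *
      omega) (sliceE_le_sliceF h (Set.mem_singleton _) hf) hv
  have e3 : ⁅f, u⁆ = 0 := by
    refine Submodule.disjoint_def.1 (sliceF_disjoint h (s := Set.Iic 0) (t := Set.Ioi 0)
      (by rw [Set.disjoint_left]; intro a ha hb; exact absurd (Set.mem_Ioi.1 hb) (not_lt.2 (Set.mem_Iic.1 ha)))) _ e1 ?_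
    rw [lie_add] at hy
    rw [eq_neg_of_add_eq_zero_left hy]
    exact neg_mem e2
  have hu' : u ∈ sliceF (-h) (Set.Ici 1) := by
    have : sliceF h (Set.Iio 0) ≤ sliceF (-h) (Set.Ici 1) := by
      refine sliceF_le fun j hj => ?_
      have := sliceE_neg h (-j)
      rw [neg_neg] at this
      rw [← this]
      refine sliceE_le_sliceF _ ?_
      simp only [Set.mem_Ici, Set.mem_Iio] at *
      omega
    exact this hu
  have hu0 : u = 0 := slice_injective t.symm (zero_mem _) hu' (by rw [add_zero]; exact e3)
  rw [hu0, zero_add]; exact hv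

/-- Upper bound for the centralizer of `e + b`. -/
lemma slice_finrank_ker_le [FiniteDimensional ℂ L] [LieAlgebra.IsKilling ℂ L] {h e b : L}
    (htop : sliceF h Set.univ = ⊤) (he : e ∈ sliceE h (-1))
    (hb : b ∈ sliceF h (Set.Ici 0))
    (hinj : ∀ z ∈ sliceF h (Set.Ici 1), ⁅e + b, z⁆ = 0 → z = 0) :
    finrank ℂ (LinearMap.ker (LieAlgebra.ad ℂ L (e + b))) ≤ finrank ℂ (sliceE h 0) := by
  set A := LieAlgebra.ad ℂ L (e + b) with hA
  set F0 := sliceF h (Set.Ici 0)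
  set F1 := sliceF h (Set.Ici 1)
  have hnd := LieAlgebra.IsKilling.killingForm_nondegenerate ℂ L
  have hmap : F1.map A ≤ LinearMap.range A ⊓ F0 := by
    rintro _ ⟨z, hz, rfl⟩
    refine ⟨⟨z, rfl⟩, ?_⟩
    rw [hA, LieAlgebra.ad_apply, add_lie]
    refine add_mem (sliceF_lie (s := {-1}) ?_ (sliceE_le_sliceF h (Set.mem_singleton _) he) hz)
      (sliceF_lie ?_ hb hz)
    · intro i hi j hj
      simp only [Set.mem_singleton_iff, Set.mem_Ici] at *
      omega
    · intro i hi j hj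
      simp only [Set.mem_Ici] at *
      omega
  have hmapdim : finrank ℂ (F1.map A) = finrank ℂ F1 := by
    have hi : Function.Injective (A.domRestrict F1) := by
      rw [← LinearMap.ker_eq_bot, LinearMap.ker_eq_bot']
      intro z hz
      exact Subtype.ext (hinj z z.2 hz)
    rw [← LinearMap.range_domRestrict, LinearMap.finrank_range_of_inj hi]
  have hsup : LinearMap.range A ⊔ F0 = ⊤ := by
    by_contra hne
    obtain ⟨φ, hφ0, hφ⟩ := Submodule.exists_le_ker_of_lt_top _ (lt_top_iff_ne_top.2 hne)
    let z := (LinearMap.BilinForm.toDual (killingForm ℂ L) hnd).symm φ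
    have hz : ∀ y, killingForm ℂ L z y = φ y := fun y =>
      LinearMap.BilinForm.apply_toDual_symm_apply (hB := hnd) φ y
    have hz1 : ⁅e + b, z⁆ = 0 := by
      apply hnd.1
      intro y
      have h1 : killingForm ℂ L ⁅e + b, z⁆ y = - killingForm ℂ L z ⁅e + b, y⁆ :=
        LieModule.traceForm_apply_lie_apply' ℂ L L (e + b) z y
      rw [h1, hz, neg_eq_zero]
      exact hφ (Submodule.mem_sup_left ⟨y, rfl⟩)
    have hz2 : ∀ y ∈ F0, killingForm ℂ L z y = 0 := fun y hy => by
      rw [hz]; exact hφ (Submodule.mem_sup_right hy)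
    have hzF : z ∈ F1 := by
      have h1 : z ∈ sliceF h (Set.Iio 1 ∪ Set.Ici 1) := by
        rw [Set.Iio_union_Ici, htop]; trivial
      obtain ⟨u, hu, v, hv, huv⟩ := Submodule.mem_sup.1 (sliceF_union_le h _ _ h1)
      have hu0 : u = 0 := by
        apply hnd.1
        intro y
        have h2 : y ∈ sliceF h (Set.Iio 0 ∪ Set.Ici 0) := by
          rw [Set.Iio_union_Ici, htop]; trivial
        obtain ⟨y1, hy1, y2, hy2, rfl⟩ := Submodule.mem_sup.1 (sliceF_union_le h _ _ h2)
        have k1 : killingForm ℂ L u y1 = 0 := sliceF_killing (by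
          intro i hi j hj
          simp only [Set.mem_Iio] at *
          omega) hu hy1
        have k2 : killingForm ℂ L v y2 = 0 := sliceF_killing (by
          intro i hi j hj
          simp only [Set.mem_Ici] at *
          omega) hv hy2
        have k3 := hz2 y2 hy2
        rw [← huv, map_add, LinearMap.add_apply, k2, add_zero] at k3
        rw [map_add, k1, k3, add_zero]
      rw [← huv, hu0, zero_add]; exact hv
    apply hφ0
    have := hinj z hzF hz1
    ext y
    rw [← hz, this]; simp
  have d1 := Submodule.finrank_sup_add_finrank_inf_eq (LinearMap.range A) F0
  rw [hsup, finrank_top] at d1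
  have d2 := Submodule.finrank_mono hmap
  have d3 : finrank ℂ F0 ≤ finrank ℂ (sliceE h 0) + finrank ℂ F1 := by
    have : F0 ≤ sliceE h 0 ⊔ F1 := by
      refine sliceF_le fun j hj => ?_
      rcases eq_or_lt_of_le (Set.mem_Ici.1 hj) with h1 | h1
      · rw [← h1]; exact le_sup_left
      · exact (sliceE_le_sliceF h (Set.mem_Ici.2 (by omega))).trans le_sup_right
    exact (Submodule.finrank_mono this).trans (Submodule.finrank_add_le_finrank_add_finrank _ _)
  have d4 := LinearMap.finrank_range_add_finrank_ker A
  omega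

/-- `h` is a regular semisimple element: its Engel subalgebra is the degree zero part. -/
lemma slice_engel_le {h : L} (htop : sliceF h Set.univ = ⊤) :
    (LieSubalgebra.engel ℂ h).toSubmodule ≤ sliceE h 0 := by
  intro v hv
  have hv' : v ∈ (LieAlgebra.ad ℂ L h).maxGenEigenspace 0 := hv
  have h1 : v ∈ sliceF h ({0} ∪ {0}ᶜ) := by
    rw [Set.union_compl_self, htop]; trivial
  obtain ⟨u, hu, w, hw, rfl⟩ := Submodule.mem_sup.1 (sliceF_union_le h _ _ h1)
  have hu' : u ∈ sliceE h 0 := by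
    have : sliceF h {0} ≤ sliceE h 0 := sliceF_le fun j hj => by
      rw [Set.mem_singleton_iff.1 hj]
    exact this hu
  have hu2 : u ∈ (LieAlgebra.ad ℂ L h).maxGenEigenspace 0 := by
    have : sliceE h 0 ≤ (LieAlgebra.ad ℂ L h).maxGenEigenspace 0 := by
      have := (LieAlgebra.ad ℂ L h).eigenspace_le_maxGenEigenspace (μ := 0)
      simpa [sliceE] using this
    exact this hu'
  have hw2 : w ∈ (LieAlgebra.ad ℂ L h).maxGenEigenspace 0 := by
    have := sub_mem hv' hu2
    simpa using this
  have hw3 : w ∈ ⨆ μ : ℂ, ⨆ _ : μ ≠ 0, (LieAlgebra.ad ℂ L h).maxGenEigenspace μ := by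
    have : sliceF h {0}ᶜ ≤ ⨆ μ : ℂ, ⨆ _ : μ ≠ 0, (LieAlgebra.ad ℂ L h).maxGenEigenspace μ := by
      refine sliceF_le fun j hj => ?_
      refine le_iSup₂_of_le (-2 * (j : ℂ)) (by simpa using hj) ?_
      rw [sliceE]
      exact Module.End.eigenspace_le_maxGenEigenspace
    exact this hw
  have hw0 := Submodule.disjoint_def.1
    ((LieAlgebra.ad ℂ L h).independent_maxGenEigenspace 0) w hw2 hw3
  rw [hw0, add_zero]; exact hu'

end

/-- Let `(ξ, h, η)` be the `sl₂`-triple constructed from the Borel subalgebra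
`𝔟₊` (with `ξ = Σ_{α ∈ Π} e₋_α`, `η = Σ_{α ∈ Π} c_α • e_α`, `h ∈ 𝔥` with `α h = -2` for all
simple roots `α ∈ Π`, the simple roots being denoted `Δs` below), and let `a ∈ 𝔟₊`.  Then
every element of the Slodowy slice `S(ξ,h,η) = ξ + ker (ad η)` translated by `ℂ • a` is a
regular element of `𝔤`: for all `y ∈ ker (ad η)` and all `λ ∈ ℂ`, the element `ξ + y + λ • a`
is regular, i.e. `dim ker (ad (ξ + y + λ • a)) = r` where `r` is the rank of `𝔤`.
(Equivalently, `S(ξ,h,η) ∩ (𝔤_sing + ℂ • a) = ∅`.) -/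
theorem slodowySlice_add_line_isRegular
    {L : Type*} [LieRing L] [LieAlgebra ℂ L] [FiniteDimensional ℂ L]
    [LieAlgebra.IsSemisimple ℂ L]
    (r : ℕ) (hr : LieAlgebra.rank ℂ L = r)
    (H : LieSubalgebra ℂ L) (hH : H.IsCartanSubalgebra)
    (Δp Δs : Finset (Module.Dual ℂ H)) (hΔs : Δs ⊆ Δp)
    (hpos : ↑Δp ⊆ rootSet H)
    (hroots : rootSet H = ↑Δp ∪ (fun α => -α) '' ↑Δp)
    (hdisj : ∀ β ∈ Δp, -β ∉ Δp)
    (hdecomp : H.toSubmodule ⊔ ⨆ β ∈ rootSet H, eigenSpace H β = ⊤)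
    (hsimple : ∀ β ∈ Δp, ∃ k : Module.Dual ℂ H → ℕ, β = ∑ α ∈ Δs, k α • α)
    (hindec : ∀ α ∈ Δs, ¬∃ β ∈ Δp, ∃ γ ∈ Δp, α = β + γ)
    (ePlus eMinus : Module.Dual ℂ H → L)
    (hplus : ∀ α ∈ Δs, ePlus α ∈ eigenSpace H α)
    (hminus : ∀ α ∈ Δs, eMinus α ∈ eigenSpace H (-α))
    (coroot : Module.Dual ℂ H → H)
    (hcoroot : ∀ α ∈ Δs, α (coroot α) = 2)
    (hbracket : ∀ α ∈ Δs, ⁅ePlus α, eMinus α⁆ = (coroot α : L))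
    (h : H) (hh : ∀ α ∈ Δs, α h = -2)
    (habel : ∀ y : H, ⁅(h : L), (y : L)⁆ = 0)
    (c : Module.Dual ℂ H → ℂ)
    (hc : -(h : L) = ∑ α ∈ Δs, c α • (coroot α : L))
    (ξ η : L) (hξ : ξ = ∑ α ∈ Δs, eMinus α) (hη : η = ∑ α ∈ Δs, c α • ePlus α)
    (htriple : ⁅(h : L), ξ⁆ = (2 : ℂ) • ξ ∧ ⁅(h : L), η⁆ = (-2 : ℂ) • η ∧ ⁅ξ, η⁆ = (h : L))
    (a : L) (ha : a ∈ borelPlus H Δp) :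
    ∀ y ∈ LinearMap.ker (LieAlgebra.ad ℂ L η), ∀ lam : ℂ,
      finrank ℂ (LinearMap.ker (LieAlgebra.ad ℂ L (ξ + y + lam • a))) = r := by
  classical
  intro y hy lam
  have hy' : ⁅η, y⁆ = 0 := by simpa using hy
  haveI := hH
  obtain ⟨ht1, ht2, ht3⟩ := htriple
  have hab : ∀ u v : H, ⁅(u : L), (v : L)⁆ = 0 := by
    intro u v
    have : ⁅u, v⁆ = 0 := trivial_lie_zero H H u v
    exact congrArg Subtype.val this
  have hH0 : H.toSubmodule ≤ eigenSpace H 0 := by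
    intro v hv u
    have := hab u ⟨v, hv⟩
    rw [LinearMap.zero_apply, zero_smul]
    exact this
  have hS : ⨆ α ∈ insert 0 (Δp ∪ Δp.image (fun α => -α)), eigenSpace H α = ⊤ := by
    rw [eq_top_iff, ← hdecomp]
    refine sup_le ?_ (iSup₂_le fun β hβ => ?_)
    · exact hH0.trans (le_iSup₂_of_le 0 (Finset.mem_insert_self _ _) le_rfl)
    · refine le_iSup₂_of_le β ?_ le_rfl
      rw [hroots] at hβ
      rcases hβ with hβ | ⟨α, hα, rfl⟩
      · exact Finset.mem_insert_of_mem (Finset.mem_union_left _ hβ)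
      · exact Finset.mem_insert_of_mem
          (Finset.mem_union_right _ (Finset.mem_image_of_mem _ hα))
  have hlow := slice_finrank_le_ker H _ hS
  have hE : ∀ (β : Module.Dual ℂ H) (j : ℤ), β h = -2 * (j : ℂ) →
      eigenSpace H β ≤ sliceE (h : L) j := by
    intro β j hj x hx
    have e : ⁅(h : L), x⁆ = β h • x := hx h
    rw [mem_sliceE, e, hj]
  have hht : ∀ β ∈ Δp, ∃ j : ℤ, 1 ≤ j ∧ β h = -2 * (j : ℂ) := by
    intro β hβ
    obtain ⟨k, hk⟩ := hsimple β hβ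
    refine ⟨((∑ α ∈ Δs, k α : ℕ) : ℤ), ?_, ?_⟩
    · have : (∑ α ∈ Δs, k α) ≠ 0 := by
        intro h0
        rw [Finset.sum_eq_zero_iff] at h0
        refine (hpos hβ).1 ?_
        rw [hk]
        exact Finset.sum_eq_zero fun α hα => by rw [h0 α hα, zero_smul]
      omega
    · rw [hk, LinearMap.sum_apply]
      push_cast
      rw [Finset.mul_sum]
      refine Finset.sum_congr rfl fun α hα => ?_
      rw [LinearMap.smul_apply, hh α hα, nsmul_eq_mul, mul_comm]
  have hHE : H.toSubmodule ≤ sliceE (h : L) 0 := hH0.trans (hE 0 0 (by simp))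
  have hrootF : ⨆ β ∈ rootSet H, eigenSpace H β ≤ sliceF (h : L) {0}ᶜ := by
    refine iSup₂_le fun β hβ => ?_
    rw [hroots] at hβ
    rcases hβ with hβ | ⟨α, hα, rfl⟩
    · obtain ⟨j, hj1, hj⟩ := hht β hβ
      refine (hE β j hj).trans (sliceE_le_sliceF _ ?_)
      simp only [Set.mem_compl_iff, Set.mem_singleton_iff]
      omega
    · obtain ⟨j, hj1, hj⟩ := hht α hα
      refine (hE (-α) (-j) ?_).trans (sliceE_le_sliceF _ ?_)
      · rw [LinearMap.neg_apply, hj]; push_cast; ring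
      · simp only [Set.mem_compl_iff, Set.mem_singleton_iff]
        omega
  have htop : sliceF (h : L) Set.univ = ⊤ := by
    rw [eq_top_iff, ← hdecomp]
    exact sup_le (hHE.trans (sliceE_le_sliceF _ (Set.mem_univ _)))
      (hrootF.trans (sliceF_mono _ (Set.subset_univ _)))
  have hE0 : sliceE (h : L) 0 = H.toSubmodule := by
    refine le_antisymm ?_ hHE
    intro v hv
    have hv' : v ∈ H.toSubmodule ⊔ ⨆ β ∈ rootSet H, eigenSpace H β := by
      rw [hdecomp]; trivial
    obtain ⟨u, hu, w, hw, rfl⟩ := Submodule.mem_sup.1 hv'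
    have hw1 : w ∈ sliceE (h : L) 0 := by
      have := sub_mem hv (hHE hu)
      simpa using this
    have hw0 : w = 0 := Submodule.disjoint_def.1
      (sliceF_disjoint (h : L) (s := {0}) (t := {0}ᶜ) disjoint_compl_right) w
      (sliceE_le_sliceF _ (Set.mem_singleton _) hw1) (hrootF hw)
    rw [hw0, add_zero]; exact hu
  have hdim : finrank ℂ (sliceE (h : L) 0) = finrank ℂ H := by rw [hE0]; rfl
  have hrH : r = finrank ℂ H := by
    apply le_antisymm
    · rw [← hr, ← hdim]
      exact (LieAlgebra.rank_le_finrank_engel ℂ (h : L)).trans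
        (Submodule.finrank_mono (slice_engel_le htop))
    · obtain ⟨z, hz⟩ := LieAlgebra.exists_isRegular ℂ L
      rw [← hr, ← (LieAlgebra.isRegular_iff_finrank_engel_eq_rank ℂ z).1 hz]
      refine (hlow z).trans ?_
      have : LinearMap.ker (LieAlgebra.ad ℂ L z) ≤ (LieSubalgebra.engel ℂ z).toSubmodule := by
        rw [← Module.End.eigenspace_zero]
        exact Module.End.eigenspace_le_maxGenEigenspace
      exact Submodule.finrank_mono this
  have haF : a ∈ sliceF (h : L) (Set.Ici 0) := by
    have : borelPlus H Δp ≤ sliceF (h : L) (Set.Ici 0) := by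
      refine sup_le (hHE.trans (sliceE_le_sliceF _ (by simp))) (iSup₂_le fun β hβ => ?_)
      obtain ⟨j, hj1, hj⟩ := hht β hβ
      exact (hE β j hj).trans (sliceE_le_sliceF _ (Set.mem_Ici.2 (by omega)))
    exact this ha
  have hξE : ξ ∈ sliceE (h : L) (-1) := by
    rw [mem_sliceE, ht1]; norm_num
  have hmain : y ∈ sliceF (h : L) (Set.Ici 0) ∧ ∀ b ∈ sliceF (h : L) (Set.Ici 0),
      ∀ z ∈ sliceF (h : L) (Set.Ici 1), ⁅ξ + b, z⁆ = 0 → z = 0 := by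
    by_cases h0 : (h : L) = 0
    · have hbot : ∀ j : ℤ, j ≠ 0 → sliceE (h : L) j = ⊥ := by
        intro j hj
        rw [eq_bot_iff]
        intro x hx
        rw [mem_sliceE, h0, zero_lie, eq_comm, smul_eq_zero] at hx
        rcases hx with hx | hx
        · exact absurd (by simpa using hx) hj
        · simpa using hx
      refine ⟨?_, fun b _ z hz _ => ?_⟩
      · have : sliceF (h : L) Set.univ ≤ sliceF (h : L) (Set.Ici 0) := by
          refine sliceF_le fun j _ => ?_
          by_cases hj : j = 0
          · exact sliceE_le_sliceF _ (Set.mem_Ici.2 hj.ge)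
          · rw [hbot j hj]; exact bot_le
        apply this
        rw [htop]; trivial
      · have : sliceF (h : L) (Set.Ici 1) ≤ ⊥ := by
          refine sliceF_le fun j hj => ?_
          have := Set.mem_Ici.1 hj
          rw [hbot j (by omega)]
        simpa using this hz
    · have t : IsSl2Triple (h : L) ξ η := by
        refine ⟨h0, ht3, ?_, ?_⟩
        · rw [ht1, two_smul, two_nsmul]
        · rw [ht2, neg_smul, two_smul, two_nsmul]
      exact ⟨slice_ker_f_le t htop hy', fun b hb z hz hz0 => slice_injective t hb hz hz0⟩
  have hbF : y + lam • a ∈ sliceF (h : L) (Set.Ici 0) :=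
    add_mem hmain.1 (Submodule.smul_mem _ _ haF)
  rw [hrH, add_assoc]
  refine le_antisymm ?_ (hlow _)
  rw [← hdim]
  exact slice_finrank_ker_le htop hξE hbF (hmain.2 _ hbF)
end

section
/- The principal nilpotent element ξ := Σ_{α∈Π} e_{−α}, the sum over the simple roots of chosen nonzero root vectors e_{−α} ∈ 𝔤_{−α}, is a regular element of 𝔤: dim ker(ad_ξ) = r. -/
open Module

set_option linter.unusedSectionVars false


namespace PN
section PartA
variable {ι M N : Type*} [Fintype ι] [AddCommGroup M] [Module ℂ M] [AddCommGroup N] [Module ℂ N]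
  (P : RootPairing ι ℂ M N) [P.IsCrystallographic]

/-- integer pairing of a formal combination of roots with a coroot -/
noncomputable def qv (k : ι → ℤ) (d : ι) : ℤ := ∑ i, k i * P.pairingIn ℤ i d

/-- formal combination of roots -/
noncomputable def E (k : ι → ℤ) : M := ∑ i, k i • P.root i

/-- canonical invariant form on roots -/
noncomputable def Q (i j : ι) : ℤ := ∑ d, P.pairingIn ℤ i d * P.pairingIn ℤ j d

lemma two_mul_Q (i j : ι) : 2 * Q P i j = P.pairingIn ℤ i j * Q P j j := by
  have := P.toInvariantForm.two_mul_apply_root_root i j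
  have h2 : ∀ i j, P.RootForm (P.root i) (P.root j) = ((Q P i j : ℤ) : ℂ) := by
    intro i j
    rw [RootPairing.rootForm_apply_apply]
    simp only [Q, Int.cast_sum, Int.cast_mul, RootPairing.root_coroot'_eq_pairing]
    refine Finset.sum_congr rfl fun d _ => ?_
    rw [← P.algebraMap_pairingIn ℤ, ← P.algebraMap_pairingIn ℤ]; simp
  change 2 * P.RootForm _ _ = _ * P.RootForm _ _ at this
  rw [h2, h2, ← P.algebraMap_pairingIn ℤ] at this
  simp only [algebraMap_int_eq, eq_intCast] at this
  exact_mod_cast this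

lemma pair_self (i : ι) : P.pairingIn ℤ i i = 2 := by
  have := P.algebraMap_pairingIn ℤ i i
  rw [P.pairing_same] at this
  rw [algebraMap_int_eq, eq_intCast] at this
  exact_mod_cast this

lemma Q_self_pos (i : ι) : 0 < Q P i i := by
  unfold Q
  refine Finset.sum_pos' (fun d _ => mul_self_nonneg _) ⟨i, Finset.mem_univ _, ?_⟩
  rw [pair_self]; norm_num

lemma Q_comm (i j : ι) : Q P i j = Q P j i := by
  unfold Q; exact Finset.sum_congr rfl fun d _ => mul_comm _ _

lemma Q_pos_iff (i j : ι) : 0 < Q P i j ↔ 0 < P.pairingIn ℤ i j := by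
  have h := two_mul_Q P i j
  have h2 := Q_self_pos P j
  constructor
  · intro h3; by_contra h4; nlinarith
  · intro h3; nlinarith

lemma Q_neg_iff (i j : ι) : Q P i j < 0 ↔ P.pairingIn ℤ i j < 0 := by
  have h := two_mul_Q P i j
  have h2 := Q_self_pos P j
  constructor
  · intro h3; by_contra h4; nlinarith
  · intro h3; nlinarith

lemma E_add (k l : ι → ℤ) : E P (k + l) = E P k + E P l := by
  simp [E, add_smul, Finset.sum_add_distrib]

lemma E_neg (k : ι → ℤ) : E P (-k) = - E P k := by
  simp [E]

lemma E_sub (k l : ι → ℤ) : E P (k - l) = E P k - E P l := by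
  rw [sub_eq_add_neg, E_add, E_neg, sub_eq_add_neg]

lemma E_single [DecidableEq ι] (i : ι) : E P (Pi.single i 1) = P.root i := by
  unfold E
  rw [Finset.sum_eq_single i]
  · simp
  · intro b _ hb; simp [hb]
  · simp

lemma E_coroot (k : ι → ℤ) (d : ι) : P.toLinearMap (E P k) (P.coroot d) = ((qv P k d : ℤ) : ℂ) := by
  simp only [E, qv, map_sum, LinearMap.sum_apply, Int.cast_sum, Int.cast_mul]
  refine Finset.sum_congr rfl fun i _ => ?_
  rw [map_zsmul, LinearMap.smul_apply, RootPairing.root_coroot_eq_pairing,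
    ← P.algebraMap_pairingIn ℤ]
  simp

lemma E_eq_zero_iff [P.IsRootSystem] (k : ι → ℤ) : E P k = 0 ↔ ∀ d, qv P k d = 0 := by
  constructor
  · intro h d
    have := E_coroot P k d
    rw [h] at this
    simp at this
    exact_mod_cast this.symm
  · intro h
    have h1 : P.toLinearMap (E P k) = 0 := by
      apply LinearMap.ext_on_range (v := P.coroot) (RootPairing.IsRootSystem.span_coroot_eq_top)
      intro d
      rw [E_coroot, h d]; simp
    have := P.toPerfPair.injective
    apply this
    ext x
    simp [h1]

lemma qv_of_root (k : ι → ℤ) (j : ι) (h : E P k = P.root j) (d : ι) :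
    qv P k d = P.pairingIn ℤ j d := by
  have := E_coroot P k d
  rw [h, RootPairing.root_coroot_eq_pairing, ← P.algebraMap_pairingIn ℤ] at this
  simp at this
  exact this.symm

lemma sum_qv_mul (k l : ι → ℤ) :
    ∑ d, qv P k d * qv P l d = ∑ i, ∑ j, k i * l j * Q P i j := by
  have h1 : ∀ d, qv P k d * qv P l d =
      ∑ i, ∑ j, k i * l j * (P.pairingIn ℤ i d * P.pairingIn ℤ j d) := by
    intro d
    simp only [qv, Finset.sum_mul_sum]
    refine Finset.sum_congr rfl fun i _ => Finset.sum_congr rfl fun j _ => by ring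
  simp only [h1, Q, Finset.mul_sum]
  rw [Finset.sum_comm]
  refine Finset.sum_congr rfl fun i _ => ?_
  rw [Finset.sum_comm]

/-- if a combination of roots is a root then some term is positive -/
lemma exists_pos_term (k : ι → ℤ) (j : ι) (h : E P k = P.root j) :
    ∃ i, 0 < k i * Q P j i := by
  by_contra hcon
  push Not at hcon
  have h1 : Q P j j = ∑ i, k i * Q P j i := by
    calc Q P j j = ∑ d, P.pairingIn ℤ j d * qv P k d := by
          unfold Q; exact Finset.sum_congr rfl fun d _ => by rw [qv_of_root P k j h]
      _ = _ := by
          simp only [qv, Q, Finset.mul_sum]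
          rw [Finset.sum_comm]
          refine Finset.sum_congr rfl fun i _ => Finset.sum_congr rfl fun d _ => by ring
  have h2 := Q_self_pos P j
  have h3 : ∑ i, k i * Q P j i ≤ 0 := Finset.sum_nonpos fun i _ => hcon i
  omega

lemma sub_mem_of_pos {i j : ι} [P.IsReduced] (h : 0 < Q P i j) (hne : P.root i ≠ P.root j) :
    P.root i - P.root j ∈ Set.range P.root :=
  P.root_sub_root_mem_of_pairingIn_pos ((Q_pos_iff P i j).1 h) (fun h => hne (by rw [h]))

lemma obtuse [P.IsReduced] {i j : ι} (h : P.root i - P.root j ∉ Set.range P.root)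
    (hne : i ≠ j) : Q P i j ≤ 0 := by
  by_contra hc
  exact h (P.root_sub_root_mem_of_pairingIn_pos ((Q_pos_iff P i j).1 (not_le.1 hc)) hne)

end PartA
end PN


namespace PN
section PartA
variable {ι M N : Type*} [Fintype ι] [AddCommGroup M] [Module ℂ M] [AddCommGroup N] [Module ℂ N]
  (P : RootPairing ι ℂ M N) [P.IsCrystallographic] [P.IsRootSystem] [P.IsReduced]

lemma natAbs_sum_lt (k l : ι → ℤ) (b : ι) (hb : (l b).natAbs < (k b).natAbs)
    (h : ∀ i, i ≠ b → l i = k i) : ∑ i, (l i).natAbs < ∑ i, (k i).natAbs := by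
  apply Finset.sum_lt_sum
  · intro i _
    by_cases hi : i = b
    · subst hi; omega
    · rw [h i hi]
  · exact ⟨b, Finset.mem_univ _, hb⟩

lemma Q_sub {i j l : ι} (h : P.root l = P.root i - P.root j) (x : ι) :
    Q P l x = Q P i x - Q P j x := by
  classical
  have h1 : ∀ d, P.pairingIn ℤ l d = P.pairingIn ℤ i d - P.pairingIn ℤ j d := by
    intro d
    have h2 := qv_of_root P (Pi.single i 1 - Pi.single j 1) l (by rw [E_sub, E_single, E_single, h]) d
    rw [← h2]
    simp [qv, sub_mul, Finset.sum_sub_distrib, Pi.single_apply]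
  simp only [Q, h1, ← Finset.sum_sub_distrib]
  exact Finset.sum_congr rfl fun d _ => by ring

lemma sign_aux (B : Finset ι)
    (hB : ∀ i ∈ B, ∀ j ∈ B, P.root i - P.root j ∉ Set.range P.root)
    (hind : ∀ k : ι → ℤ, (∀ i ∉ B, k i = 0) → E P k = 0 → k = 0)
    (k : ι → ℤ)
    (IH : ∀ l : ι → ℤ, ∑ i, (l i).natAbs < ∑ i, (k i).natAbs → (∀ i ∉ B, l i = 0) →
      E P l ∈ Set.range P.root → (∀ i, 0 ≤ l i) ∨ (∀ i, l i ≤ 0))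
    (hk : ∀ i ∉ B, k i = 0) (j : ι) (hj : E P k = P.root j) (b : ι) (hb : 0 < k b)
    (hbj : 0 < Q P j b) : (∀ i, 0 ≤ k i) ∨ (∀ i, k i ≤ 0) := by
  classical
  by_contra hcon
  push Not at hcon
  obtain ⟨⟨x, hx⟩, -⟩ := hcon
  have hbB : b ∈ B := by by_contra h; rw [hk b h] at hb; omega
  have hne : P.root j ≠ P.root b := by
    intro h
    have h1 : k - Pi.single b 1 = 0 := by
      apply hind
      · intro i hi
        have : i ≠ b := by rintro rfl; exact hi hbB
        simp [hk i hi, this]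
      · rw [E_sub, E_single, hj, h, sub_self]
    have h2 := congrFun h1 x
    by_cases hxb : x = b
    · subst hxb; omega
    · simp [hxb] at h2; omega
  have hkb : ∀ i, (k - Pi.single b 1 : ι → ℤ) i ≤ 0 := by
    rcases IH (k - Pi.single b 1) (natAbs_sum_lt _ _ b (by simp; omega) (by intro i hi; simp [hi]))
      (by
        intro i hi
        have : i ≠ b := by rintro rfl; exact hi hbB
        simp [hk i hi, this])
      (by rw [E_sub, E_single, hj]; exact sub_mem_of_pos P hbj hne) with h | h
    · exfalso
      have h2 := h x
      by_cases hxb : x = b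
      · subst hxb; omega
      · simp [hxb] at h2; omega
    · exact h
  have hkb1 : k b = 1 := by have := hkb b; simp at this; omega
  have hkle : ∀ i, i ≠ b → k i ≤ 0 := by intro i hi; have := hkb i; simpa [hi] using this
  obtain ⟨j', hj'⟩ := sub_mem_of_pos P (i := b) (j := j) (by rw [Q_comm]; exact hbj) hne.symm
  obtain ⟨b1, hb1⟩ := exists_pos_term P (Pi.single b 1 - k) j' (by rw [E_sub, E_single, hj, hj'])
  have hb1b : b1 ≠ b := by rintro rfl; simp [hkb1] at hb1
  have hkb1' := hkle b1 hb1b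
  have hb2 : 0 < - k b1 * Q P j' b1 := by simpa [hb1b] using hb1
  have hb3 : k b1 < 0 := by
    rcases hkb1'.lt_or_eq with h | h
    · exact h
    · rw [h] at hb2; simp at hb2
  have hb4 : 0 < Q P j' b1 := by
    by_contra h; nlinarith
  have hb1B : b1 ∈ B := by by_contra h; rw [hk b1 h] at hb3; omega
  have hb5 : Q P b b1 ≤ 0 := obtuse P (hB b hbB b1 hb1B) hb1b.symm
  have hb6 := Q_sub P hj' b1
  have hb7 : Q P j b1 < 0 := by omega
  have hne2 : P.root j ≠ - P.root b1 := by
    intro h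
    have h1 : k + Pi.single b1 1 = 0 := by
      apply hind
      · intro i hi
        have : i ≠ b1 := by rintro rfl; exact hi hb1B
        simp [hk i hi, this]
      · rw [E_add, E_single, hj, h, neg_add_cancel]
    have h2 := congrFun h1 b
    simp [hb1b.symm, hkb1] at h2
  have hroot : P.root j + P.root b1 ∈ Set.range P.root :=
    P.root_add_root_mem_of_pairingIn_neg ((Q_neg_iff P j b1).1 hb7) hne2
  have hge : ∀ i, 0 ≤ (k + Pi.single b1 1 : ι → ℤ) i := by
    rcases IH (k + Pi.single b1 1) (natAbs_sum_lt _ _ b1 (by simp; omega) (by intro i hi; simp [hi]))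
      (by
        intro i hi
        have : i ≠ b1 := by rintro rfl; exact hi hb1B
        simp [hk i hi, this])
      (by rw [E_add, E_single, hj]; exact hroot) with h | h
    · exact h
    · exfalso
      have h2 := h b
      simp [hb1b.symm, hkb1] at h2
  have hfin : k = Pi.single b 1 - Pi.single b1 1 := by
    ext i
    by_cases h1 : i = b
    · subst h1; simp [hb1b.symm, hkb1]
    · have h3 := hkle i h1
      have h4 := hge i
      by_cases h2 : i = b1
      · subst h2; simp at h4; simp [h1]; omega
      · simp [h2] at h4; simp [h1, h2]; omega
  apply hB b hbB b1 hb1B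
  rw [hfin, E_sub, E_single, E_single] at hj
  exact ⟨j, hj.symm⟩

lemma neg_root_mem' (j : ι) : - P.root j ∈ Set.range P.root :=
  ⟨P.reflectionPerm j j, by simp⟩

lemma sign (B : Finset ι)
    (hB : ∀ i ∈ B, ∀ j ∈ B, P.root i - P.root j ∉ Set.range P.root)
    (hind : ∀ k : ι → ℤ, (∀ i ∉ B, k i = 0) → E P k = 0 → k = 0) :
    ∀ (n : ℕ) (k : ι → ℤ), ∑ i, (k i).natAbs = n → (∀ i ∉ B, k i = 0) →
      E P k ∈ Set.range P.root → (∀ i, 0 ≤ k i) ∨ (∀ i, k i ≤ 0) := by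
  intro n
  induction n using Nat.strong_induction_on with
  | _ n ih =>
  intro k hn hk hE
  have IH : ∀ l : ι → ℤ, ∑ i, (l i).natAbs < ∑ i, (k i).natAbs → (∀ i ∉ B, l i = 0) →
      E P l ∈ Set.range P.root → (∀ i, 0 ≤ l i) ∨ (∀ i, l i ≤ 0) := by
    intro l hl
    exact ih _ (hn ▸ hl) l rfl
  obtain ⟨j, hj⟩ := hE
  obtain ⟨b, hb⟩ := exists_pos_term P k j hj.symm
  rcases lt_or_ge 0 (k b) with h | h
  · exact sign_aux P B hB hind k IH hk j hj.symm b h (by by_contra hc; nlinarith)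
  · obtain ⟨j', hj'⟩ := neg_root_mem' P j
    have h1 : E P (-k) = P.root j' := by rw [E_neg, ← hj, hj']
    have h0 : k b < 0 := by
      rcases h.lt_or_eq with h | h
      · exact h
      · rw [h] at hb; simp at hb
    have h2 : 0 < Q P j' b := by
      have h3 : Q P j b < 0 := by by_contra hc; nlinarith
      have h4 : P.root j' = P.root j' - P.root j' - P.root j := by rw [hj']; abel
      have h5 : Q P j' b = - Q P j b := by
        have h6 : ∀ d, P.pairingIn ℤ j' d = - P.pairingIn ℤ j d := by
          intro d
          have h7 := qv_of_root P (-k) j' h1 d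
          have h8 := qv_of_root P k j hj.symm d
          rw [← h7, ← h8]
          simp [qv]
        simp [Q, h6]
      omega
    have := sign_aux P B hB hind (-k) (by simpa using IH) (by simpa using hk) j' h1 b
      (by simpa using h0) h2
    rcases this with h | h
    · right; intro i; have := h i; simp at this; exact this
    · left; intro i; have := h i; simp at this; exact this

end PartA
end PN


namespace PN
section PartA
variable {ι M N : Type*} [Fintype ι] [AddCommGroup M] [Module ℂ M] [AddCommGroup N] [Module ℂ N]
  (P : RootPairing ι ℂ M N) [P.IsCrystallographic] [P.IsRootSystem] [P.IsReduced]

lemma pos_part_rel (C : Finset ι) (hC : ∀ i ∈ C, ∀ j ∈ C, i ≠ j → Q P i j ≤ 0)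
    (k : ι → ℤ) (hk : ∀ i ∉ C, k i = 0) (hE : E P k = 0) :
    E P (fun i => max (k i) 0) = 0 := by
  set kp : ι → ℤ := fun i => max (k i) 0 with hkp
  set km : ι → ℤ := fun i => max (- k i) 0 with hkm
  have hkk : k = kp - km := by
    ext i; simp only [hkp, hkm, Pi.sub_apply]; omega
  have h1 : ∀ d, qv P kp d = qv P km d := by
    intro d
    have h := (E_eq_zero_iff P k).1 hE d
    rw [hkk] at h
    simp only [qv, Pi.sub_apply, sub_mul, Finset.sum_sub_distrib] at h ⊢
    omega
  have h2 : ∑ d, qv P kp d * qv P kp d ≤ 0 := by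
    have h3 : ∑ d, qv P kp d * qv P kp d = ∑ d, qv P kp d * qv P km d :=
      Finset.sum_congr rfl fun d _ => by rw [h1 d]
    rw [h3, sum_qv_mul]
    refine Finset.sum_nonpos fun i _ => Finset.sum_nonpos fun j _ => ?_
    by_cases hi : 0 < k i
    · by_cases hj : k j < 0
      · have hiC : i ∈ C := by by_contra h; rw [hk i h] at hi; omega
        have hjC : j ∈ C := by by_contra h; rw [hk j h] at hj; omega
        have hne : i ≠ j := by rintro rfl; omega
        have := hC i hiC j hjC hne
        have h5 : 0 ≤ kp i * km j := mul_nonneg (le_max_right _ _) (le_max_right _ _)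
        exact mul_nonpos_of_nonneg_of_nonpos h5 this
      · have : km j = 0 := by simp only [hkm]; omega
        simp [this]
    · have : kp i = 0 := by simp only [hkp]; omega
      simp [this]
  rw [E_eq_zero_iff]
  intro d
  have h4 : ∑ d, qv P kp d * qv P kp d = 0 :=
    le_antisymm h2 (Finset.sum_nonneg fun d _ => mul_self_nonneg _)
  rw [Finset.sum_eq_zero_iff_of_nonneg (fun d _ => mul_self_nonneg _)] at h4
  have := h4 d (Finset.mem_univ _)
  exact mul_self_eq_zero.1 this

lemma linIndep_of_int (B : Finset ι)
    (hind : ∀ k : ι → ℤ, (∀ i ∉ B, k i = 0) → E P k = 0 → k = 0) :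
    LinearIndependent ℂ (fun b : B => P.root b) := by
  classical
  rw [Fintype.linearIndependent_iff]
  intro z hz
  -- extend z
  let Z : ι → ℂ := fun i => if h : i ∈ B then z ⟨i, h⟩ else 0
  have hZ : ∀ d, ∑ i, (P.pairingIn ℤ i d) • Z i = 0 := by
    intro d
    have h1 : P.toLinearMap (∑ i, z i • P.root i) (P.coroot d) = 0 := by rw [hz]; simp
    simp only [map_sum, LinearMap.sum_apply, map_smul, LinearMap.smul_apply,
      RootPairing.root_coroot_eq_pairing] at h1
    rw [← h1, ← Finset.sum_subset (Finset.subset_univ B), ← Finset.sum_coe_sort B]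
    · refine Finset.sum_congr rfl fun i _ => ?_
      simp only [Z, i.2, dif_pos, ← P.algebraMap_pairingIn ℤ]
      simp [mul_comm]
    · intro i _ hi
      simp [Z, hi]
  have key : ∀ f : ℂ →ₗ[ℚ] ℚ, ∀ i, f (Z i) = 0 := by
    intro f
    obtain ⟨D, hD⟩ := IsLocalization.exist_integer_multiples (nonZeroDivisors ℤ) Finset.univ
      (fun i => f (Z i))
    have hD' : ∀ i, ∃ k : ℤ, (k : ℚ) = (D : ℤ) * f (Z i) := by
      intro i
      obtain ⟨k, hk⟩ := hD i (Finset.mem_univ _)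
      refine ⟨k, ?_⟩
      simpa [Submonoid.smul_def] using hk
    choose k hk using hD'
    have hD0 : ((D : ℤ) : ℚ) ≠ 0 := by
      have := nonZeroDivisors.ne_zero D.2
      exact_mod_cast this
    have hk0 : k = 0 := by
      apply hind
      · intro i hi
        have := hk i
        simp [Z, hi] at this
        exact this
      · rw [E_eq_zero_iff]
        intro d
        have h1 : f (∑ i, (P.pairingIn ℤ i d) • Z i) = 0 := by rw [hZ]; simp
        simp only [map_sum, map_zsmul] at h1
        have h2 : ((qv P k d : ℤ) : ℚ) = 0 := by
          simp only [qv, Int.cast_sum, Int.cast_mul, hk]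
          have h3 : ((D : ℤ) : ℚ) * ∑ i, (P.pairingIn ℤ i d) • f (Z i) = 0 := by rw [h1, mul_zero]
          rw [← h3, Finset.mul_sum]
          refine Finset.sum_congr rfl fun i _ => ?_
          simp; ring
        exact_mod_cast h2
    intro i
    have := hk i
    rw [hk0] at this
    simp at this
    exact this
  intro i
  have h1 : Z i = 0 := by
    rw [← Module.forall_dual_apply_eq_zero_iff ℚ]
    intro f; exact key f i
  simpa [Z] using h1

lemma exists_coweight (B : Finset ι)
    (hind : ∀ k : ι → ℤ, (∀ i ∉ B, k i = 0) → E P k = 0 → k = 0) (z : ι → ℂ) :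
    ∃ h : N, ∀ b ∈ B, P.toLinearMap (P.root b) h = z b := by
  have hl := linIndep_of_int P B hind
  obtain ⟨g, hg⟩ := LinearMap.exists_leftInverse_of_injective
    (Finsupp.linearCombination ℂ (fun b : B => P.root b)) (LinearMap.ker_eq_bot.2 hl)
  let f : Dual ℂ M := (Finsupp.linearCombination ℂ (fun b : B => z b)) ∘ₗ g
  have hf : ∀ b ∈ B, f (P.root b) = z b := by
    intro b hb
    have h1 := LinearMap.congr_fun hg (Finsupp.single ⟨b, hb⟩ 1)
    simp at h1
    simp [f, h1]
  obtain ⟨h, hh⟩ := P.toLinearMap.flip.toPerfPair.surjective f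
  refine ⟨h, fun b hb => ?_⟩
  rw [← hf b hb, ← hh]
  simp

lemma flip_identity (i : ι) (w : N) :
    2 * ∑ d, ((P.pairingIn ℤ d i : ℤ) : ℂ) * P.toLinearMap (P.root d) w =
      ((∑ d, P.pairingIn ℤ d i ^ 2 : ℤ) : ℂ) * P.toLinearMap (P.root i) w := by
  let A : N →ₗ[ℂ] ℂ := (2 : ℂ) • ∑ d, ((P.pairingIn ℤ d i : ℤ) : ℂ) • P.toLinearMap (P.root d)
  let A' : N →ₗ[ℂ] ℂ := ((∑ d, P.pairingIn ℤ d i ^ 2 : ℤ) : ℂ) • P.toLinearMap (P.root i)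
  have : A = A' := by
    apply LinearMap.ext_on_range (v := P.coroot) (RootPairing.IsRootSystem.span_coroot_eq_top)
    intro j
    have h := two_mul_Q P.flip j i
    simp only [A, A', LinearMap.smul_apply, LinearMap.sum_apply, smul_eq_mul,
      RootPairing.root_coroot_eq_pairing, ← P.algebraMap_pairingIn ℤ, algebraMap_int_eq,
      eq_intCast]
    have hf : ∀ i j, P.flip.pairingIn ℤ i j = P.pairingIn ℤ j i := by
      intro i j
      have h1 := P.flip.algebraMap_pairingIn ℤ i j
      have h2 := P.algebraMap_pairingIn ℤ j i
      rw [RootPairing.pairing_flip, ← h2] at h1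
      simpa using h1
    simp only [Q, hf] at h
    have h' : 2 * ∑ d, P.pairingIn ℤ d i * P.pairingIn ℤ d j =
      (∑ d, P.pairingIn ℤ d i ^ 2) * P.pairingIn ℤ i j := by
      rw [mul_comm (∑ d, _)]
      simp only [sq, ← h]
      congr 1
      exact Finset.sum_congr rfl fun d _ => mul_comm _ _
    exact_mod_cast h'
  have h2 := LinearMap.congr_fun this w
  simpa [A, A'] using h2

end PartA
end PN


namespace PN
section PartA
variable {ι M N : Type*} [Fintype ι] [AddCommGroup M] [Module ℂ M] [AddCommGroup N] [Module ℂ N]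
  (P : RootPairing ι ℂ M N) [P.IsCrystallographic] [P.IsRootSystem] [P.IsReduced]

/-- value of the root `d` on a formal combination of coroots -/
noncomputable def uv (m : ι → ℤ) (d : ι) : ℤ := ∑ j, m j * P.pairingIn ℤ d j

lemma root_sum_coroot (m : ι → ℤ) (d : ι) :
    P.toLinearMap (P.root d) (∑ j, m j • P.coroot j) = ((uv P m d : ℤ) : ℂ) := by
  simp only [uv, map_sum, Int.cast_sum, Int.cast_mul]
  refine Finset.sum_congr rfl fun i _ => ?_
  rw [map_zsmul, RootPairing.root_coroot_eq_pairing, ← P.algebraMap_pairingIn ℤ]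
  simp

lemma descent (C : Finset ι) (n : ι → ℤ) (a : ℝ) (ha : 0 < a) (h : N)
    (hh : ∀ i ∈ C, (P.toLinearMap (P.root i) h).re = a - n i) :
    ∃ m : ι → ℤ, ∀ i ∈ C, 0 ≤ n i + uv P m i := by
  classical
  by_contra hcon
  push Not at hcon
  let F : (ι → ℤ) → ℝ := fun m => ∑ d, ((uv P m d : ℝ) - (P.toLinearMap (P.root d) h).re) ^ 2
  have hF0 : ∀ m, 0 ≤ F m := fun m => Finset.sum_nonneg fun d _ => sq_nonneg _
  have step : ∀ m, ∃ m', F m' ≤ F m - a := by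
    intro m
    obtain ⟨i, hi, hneg⟩ := hcon m
    set t : ℤ := -(n i + uv P m i) with ht
    have ht1 : 1 ≤ t := by omega
    have hu : ∀ d, uv P (m + Pi.single i t) d = uv P m d + t * P.pairingIn ℤ d i := by
      intro d
      simp [uv, add_mul, Finset.sum_add_distrib, Pi.single_apply]
    refine ⟨m + Pi.single i t, ?_⟩
    have hid := flip_identity P i ((∑ j, m j • P.coroot j) - h)
    simp only [map_sub, root_sum_coroot] at hid
    have hid2 := congrArg Complex.re hid
    have e1 : ∀ d, (((P.pairingIn ℤ d i : ℤ) : ℂ) *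
        (((uv P m d : ℤ) : ℂ) - P.toLinearMap (P.root d) h)).re =
        (P.pairingIn ℤ d i : ℝ) * ((uv P m d : ℝ) - (P.toLinearMap (P.root d) h).re) := by
      intro d
      simp [Complex.mul_re]
    have e2 : (2 * ∑ d, ((P.pairingIn ℤ d i : ℤ) : ℂ) *
        (((uv P m d : ℤ) : ℂ) - P.toLinearMap (P.root d) h)).re =
        2 * ∑ d, (P.pairingIn ℤ d i : ℝ) * ((uv P m d : ℝ) - (P.toLinearMap (P.root d) h).re) := by
      rw [Complex.mul_re, Complex.re_sum]
      simp only [e1]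
      simp
    set D : ℤ := ∑ d, P.pairingIn ℤ d i ^ 2 with hD
    have hD1 : 1 ≤ D := by
      have : P.pairingIn ℤ i i ^ 2 ≤ D :=
        Finset.single_le_sum (f := fun d => P.pairingIn ℤ d i ^ 2) (fun d _ => sq_nonneg _)
          (Finset.mem_univ i)
      rw [pair_self] at this; omega
    have e3 : (((D : ℤ) : ℂ) *
        (((uv P m i : ℤ) : ℂ) - P.toLinearMap (P.root i) h)).re =
        (D : ℝ) * ((uv P m i : ℝ) - (P.toLinearMap (P.root i) h).re) := by
      simp [Complex.mul_re]
    rw [e2, e3, hh i hi] at hid2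
    have hF : F (m + Pi.single i t) = F m + (t : ℝ) * (2 * ∑ d, (P.pairingIn ℤ d i : ℝ) *
        ((uv P m d : ℝ) - (P.toLinearMap (P.root d) h).re)) + (t : ℝ) ^ 2 * (D : ℝ) := by
      simp only [F, hu, hD, Int.cast_sum, Finset.mul_sum, ← Finset.sum_add_distrib]
      refine Finset.sum_congr rfl fun d _ => ?_
      push_cast; ring
    rw [hF, hid2]
    have htr : (t : ℝ) = -((n i : ℝ) + (uv P m i : ℝ)) := by rw [ht]; push_cast; ring
    have h5 : ((uv P m i : ℝ) - (a - (n i : ℝ))) = - t - a := by rw [htr]; ring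
    rw [h5]
    have h6 : (1 : ℝ) ≤ t := by exact_mod_cast ht1
    have h7 : (1 : ℝ) ≤ D := by exact_mod_cast hD1
    have h8 : (1 : ℝ) ≤ t * D := by nlinarith
    nlinarith
  have iter : ∀ k : ℕ, ∃ m, F m ≤ F 0 - k * a := by
    intro k
    induction k with
    | zero => exact ⟨0, by simp⟩
    | succ k ih =>
      obtain ⟨m, hm⟩ := ih
      obtain ⟨m', hm'⟩ := step m
      exact ⟨m', by push_cast; linarith⟩
  obtain ⟨k, hk⟩ := exists_nat_gt (F 0 / a)
  obtain ⟨m, hm⟩ := iter k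
  have := hF0 m
  rw [div_lt_iff₀ ha] at hk
  linarith

lemma mark (c : ι → ℤ) (hc0 : ∀ i, 0 ≤ c i) (hc : c ≠ 0) (hE : E P c = 0)
    (hmin : ∀ i0, c i0 ≠ 0 → ∀ k : ι → ℤ, (∀ i, c i = 0 → k i = 0) → k i0 = 0 →
      E P k = 0 → k = 0) :
    ∃ γ, c γ ≠ 0 ∧ ∀ i, c γ ∣ c i := by
  classical
  obtain ⟨i0, hi0⟩ := Function.ne_iff.1 hc
  simp only [Pi.zero_apply] at hi0
  obtain ⟨n, hn⟩ := Finset.gcd_eq_sum_mul Finset.univ c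
  set g := Finset.univ.gcd c with hg
  have hgdvd : ∀ i, g ∣ c i := fun i => Finset.gcd_dvd (Finset.mem_univ i)
  have hg0 : g ≠ 0 := by
    intro h
    have := hgdvd i0
    rw [h] at this
    exact hi0 (zero_dvd_iff.1 this)
  have hgpos : 0 < g := by
    have : 0 ≤ g := by
      rw [hg, ← Finset.normalize_gcd]
      rw [← Int.abs_eq_normalize]; exact abs_nonneg _
    omega
  have hS : 0 < ∑ i, c i :=
    Finset.sum_pos' (fun i _ => hc0 i) ⟨i0, Finset.mem_univ _, lt_of_le_of_ne (hc0 i0) (Ne.symm hi0)⟩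
  set a : ℝ := (g : ℝ) / (∑ i, c i : ℤ) with ha
  have hSr : (0 : ℝ) < (∑ i, c i : ℤ) := by exact_mod_cast hS
  have hapos : 0 < a := div_pos (by exact_mod_cast hgpos) hSr
  -- find h
  obtain ⟨h, hh⟩ := exists_coweight P (Finset.univ.filter fun i => c i ≠ 0 ∧ i ≠ i0)
    (by
      intro k hk hEk
      apply hmin i0 hi0 k _ _ hEk
      · intro i hi; apply hk; simp [hi]
      · apply hk; simp) (fun i => ((a - n i : ℝ) : ℂ))
  have hh' : ∀ i, c i ≠ 0 → P.toLinearMap (P.root i) h = ((a - n i : ℝ) : ℂ) := by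
    have h1 : ∀ i, c i ≠ 0 → i ≠ i0 → P.toLinearMap (P.root i) h = ((a - n i : ℝ) : ℂ) := by
      intro i hi hi'
      exact hh i (by simp [hi, hi'])
    have h2 : ∑ i, (c i : ℂ) * P.toLinearMap (P.root i) h = 0 := by
      have : P.toLinearMap (E P c) h = 0 := by rw [hE]; simp
      rw [← this]
      simp [E, map_sum, LinearMap.sum_apply]
    have h3 : ∑ i, (c i : ℂ) * ((a - n i : ℝ) : ℂ) = 0 := by
      have h4 : ∑ i, (c i : ℝ) * (a - n i) = 0 := by
        have h5 : (g : ℝ) = ∑ i, (c i : ℝ) * n i := by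
          rw [hn]; push_cast; rfl
        simp only [mul_sub, Finset.sum_sub_distrib, ← Finset.sum_mul, ← h5]
        rw [ha]
        push_cast at hSr ⊢
        field_simp
        ring
      exact_mod_cast congrArg (fun x : ℝ => (x : ℂ)) h4
    intro i hi
    by_cases hii : i = i0
    · subst hii
      have h6 : ∑ j, (c j : ℂ) * (P.toLinearMap (P.root j) h - ((a - n j : ℝ) : ℂ)) = 0 := by
        simp only [mul_sub, Finset.sum_sub_distrib, h2, h3, sub_zero]
      rw [Finset.sum_eq_single i] at h6
      · have hci : (c i : ℂ) ≠ 0 := by exact_mod_cast hi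
        have := (mul_eq_zero.1 h6).resolve_left hci
        exact sub_eq_zero.1 this
      · intro j _ hj
        by_cases hcj : c j = 0
        · simp [hcj]
        · rw [h1 j hcj hj]; simp
      · simp
    · exact h1 i hi hii
  obtain ⟨m, hm⟩ := descent P (Finset.univ.filter fun i => c i ≠ 0) n a hapos h (by
    intro i hi
    rw [hh' i (by simpa using hi)]
    exact Complex.ofReal_re _)
  have hsum : ∑ i, c i * (n i + uv P m i) = g := by
    have h7 : ∑ i, c i * uv P m i = 0 := by
      have := (E_eq_zero_iff P c).1 hE
      simp only [qv] at this
      simp only [uv, Finset.mul_sum]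
      rw [Finset.sum_comm]
      refine Finset.sum_eq_zero fun j _ => ?_
      have h8 := congrArg (fun x => m j * x) (this j)
      simp only [Finset.mul_sum, mul_zero] at h8
      rw [← h8]
      exact Finset.sum_congr rfl fun i _ => by ring
    simp only [mul_add, Finset.sum_add_distrib, h7, add_zero]
    exact hn.symm
  have hterm : ∀ i, 0 ≤ c i * (n i + uv P m i) := by
    intro i
    by_cases hci : c i = 0
    · simp [hci]
    · exact mul_nonneg (hc0 i) (hm i (by simp [hci]))
  obtain ⟨γ, -, hγ⟩ : ∃ γ ∈ Finset.univ, c γ * (n γ + uv P m γ) ≠ 0 :=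
    Finset.exists_ne_zero_of_sum_ne_zero (by rw [hsum]; exact hg0)
  have hcγ : c γ ≠ 0 := fun h => hγ (by simp [h])
  refine ⟨γ, hcγ, fun i => ?_⟩
  have hle : c γ * (n γ + uv P m γ) ≤ g := by
    rw [← hsum]
    exact Finset.single_le_sum (f := fun i => c i * (n i + uv P m i)) (fun i _ => hterm i)
      (Finset.mem_univ γ)
  have hφ : 0 < n γ + uv P m γ := by
    have h1 := hm γ (by simp [hcγ])
    rcases h1.lt_or_eq with h | h
    · exact h
    · exfalso; apply hγ; rw [← h]; simp
  have hcp : 0 < c γ := lt_of_le_of_ne (hc0 γ) (Ne.symm hcγ)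
  have hcg : c γ = g := by
    have h1 : g ≤ c γ := Int.le_of_dvd hcp (hgdvd γ)
    nlinarith
  rw [hcg]; exact hgdvd i

end PartA
end PN


namespace PN
section PartA
variable {ι M N : Type*} [Fintype ι] [AddCommGroup M] [Module ℂ M] [AddCommGroup N] [Module ℂ N]
  (P : RootPairing ι ℂ M N) [P.IsCrystallographic] [P.IsRootSystem] [P.IsReduced]

lemma exists_dep (B : Finset ι)
    (hB : ∀ i ∈ B, ∀ j ∈ B, P.root i - P.root j ∉ Set.range P.root)
    (hdep : ¬ ∀ k : ι → ℤ, (∀ i ∉ B, k i = 0) → E P k = 0 → k = 0) :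
    ∃ γ ∈ B, ∃ k : ι → ℤ, (∀ i ∉ B, k i = 0) ∧ k γ = 0 ∧ E P k = P.root γ := by
  classical
  have hob : ∀ i ∈ B, ∀ j ∈ B, i ≠ j → Q P i j ≤ 0 := fun i hi j hj h => obtuse P (hB i hi j hj) h
  let supp : (ι → ℤ) → Finset ι := fun k => Finset.univ.filter fun i => k i ≠ 0
  let T : Set ℕ := {n | ∃ k : ι → ℤ, (∀ i ∉ B, k i = 0) ∧ E P k = 0 ∧ k ≠ 0 ∧ (supp k).card = n}
  have hT : T.Nonempty := by
    push Not at hdep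
    obtain ⟨k, h1, h2, h3⟩ := hdep
    exact ⟨_, k, h1, h2, h3, rfl⟩
  have hmem := Nat.sInf_mem hT
  have hmin : ∀ k : ι → ℤ, (∀ i ∉ B, k i = 0) → E P k = 0 → k ≠ 0 → sInf T ≤ (supp k).card :=
    fun k h1 h2 h3 => Nat.sInf_le ⟨k, h1, h2, h3, rfl⟩
  obtain ⟨k, hk1, hk2, hk3, hk4⟩ := hmem
  -- nonnegative relation
  have hc : ∃ c : ι → ℤ, (∀ i, 0 ≤ c i) ∧ (∀ i ∉ B, c i = 0) ∧ E P c = 0 ∧ c ≠ 0 ∧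
      supp c ⊆ supp k := by
    by_cases h : ∃ i, 0 < k i
    · obtain ⟨i, hi⟩ := h
      refine ⟨fun i => max (k i) 0, fun i => le_max_right _ _, fun i hi => by simp [hk1 i hi],
        pos_part_rel P B hob k hk1 hk2, ?_, ?_⟩
      · intro h; have := congrFun h i; simp at this; omega
      · intro j hj; simp only [supp, Finset.mem_filter, Finset.mem_univ, true_and] at hj ⊢
        intro h; rw [h] at hj; simp at hj
    · push Not at h
      refine ⟨-k, fun i => by simpa using h i, fun i hi => by simp [hk1 i hi], by
        rw [E_neg, hk2, neg_zero], by simpa using hk3, ?_⟩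
      intro j hj; simpa [supp] using hj
  obtain ⟨c, hc0, hcB, hcE, hcne, hcs⟩ := hc
  have hccard : (supp c).card ≤ sInf T := by rw [← hk4]; exact Finset.card_le_card hcs
  obtain ⟨γ, hγ, hdvd⟩ := mark P c hc0 hcne hcE (by
    intro i0 hi0 l hl hl0 hEl
    by_contra hlne
    have h1 := hmin l (fun i hi => hl i (hcB i hi)) hEl hlne
    have h2 : (supp l).card < (supp c).card := by
      apply Finset.card_lt_card
      refine ⟨?_, ?_⟩
      · intro i hi
        simp only [supp, Finset.mem_filter, Finset.mem_univ, true_and] at hi ⊢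
        exact fun h => hi (hl i h)
      · intro h
        have : i0 ∈ supp l := h (by simp [supp, hi0])
        simp [supp, hl0] at this
    omega)
  choose d hd using hdvd
  refine ⟨γ, by by_contra h; exact hγ (hcB γ h), fun i => if i = γ then 0 else - d i, ?_, by simp, ?_⟩
  · intro i hi
    have := hd i
    rw [hcB i hi] at this
    have h0 : d i = 0 := by
      rcases mul_eq_zero.1 this.symm with h | h
      · exact absurd h hγ
      · exact h
    simp [h0]
  · have h1 : c γ • (E P d) = 0 := by
      rw [← hcE]; simp only [E, Finset.smul_sum, smul_smul]
      exact Finset.sum_congr rfl fun i _ => by rw [← hd i]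
    have h2 : E P d = 0 := by
      rw [← Int.cast_smul_eq_zsmul ℂ] at h1
      rcases smul_eq_zero.1 h1 with h | h
      · exact absurd (by exact_mod_cast h) hγ
      · exact h
    have hdγ : d γ = 1 := by
      have := hd γ
      have h3 : c γ * (d γ - 1) = 0 := by rw [mul_sub, ← this]; ring
      rcases mul_eq_zero.1 h3 with h | h
      · exact absurd h hγ
      · omega
    have h4 : (fun i => if i = γ then 0 else - d i) = Pi.single γ 1 - d := by
      ext i
      by_cases h : i = γ
      · subst h; simp [hdγ]
      · simp [h]
    rw [h4, E_sub, E_single, h2, sub_zero]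

lemma coroot_span (B : Finset ι) (hspan : ∀ j, ∃ k : ι → ℤ, (∀ i ∉ B, k i = 0) ∧ E P k = P.root j)
    (w : N) : ∃ x : ι → ℂ, w = ∑ b ∈ B, x b • P.coroot b := by
  classical
  have h1 : ∀ v : M, v ∈ Submodule.span ℂ (P.root '' B) := by
    intro v
    have hv : v ∈ Submodule.span ℂ (Set.range P.root) := by
      rw [RootPairing.IsRootSystem.span_root_eq_top]; trivial
    refine Submodule.span_le.2 ?_ hv
    rintro _ ⟨j, rfl⟩
    obtain ⟨k, hk, hE⟩ := hspan j
    rw [← hE]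
    refine Submodule.sum_mem _ fun i _ => ?_
    by_cases hi : i ∈ B
    · have hm : P.root i ∈ Submodule.span ℂ (P.root '' B) := Submodule.subset_span ⟨i, hi, rfl⟩
      exact zsmul_mem hm _
    · rw [hk i hi]; simp
  obtain ⟨v, rfl⟩ := P.PolarizationEquiv.surjective w
  have h2 := h1 v
  rw [Submodule.mem_span_image_finset_iff_exists_fun] at h2
  obtain ⟨z', rfl⟩ := h2
  let z : ι → ℂ := fun i => if h : i ∈ B then z' ⟨i, h⟩ else 0
  have hz : ∑ i, z' i • P.root i = ∑ i ∈ B, z i • P.root i := by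
    rw [← Finset.sum_coe_sort B]
    refine Finset.sum_congr rfl fun i _ => ?_
    simp [z]
  rw [hz]
  refine ⟨fun b => z b * (2 / P.RootForm (P.root b) (P.root b))⁻¹, ?_⟩
  rw [map_sum]
  refine Finset.sum_congr rfl fun b _ => ?_
  have h3 := P.coroot_eq_polarizationEquiv_apply_root b
  have h4 : (2 / P.RootForm (P.root b) (P.root b)) ≠ 0 := by
    intro h; rw [h, zero_smul] at h3; exact P.flip.ne_zero b h3
  rw [h3, map_smul, smul_smul, mul_assoc, inv_mul_cancel₀ h4, mul_one]

theorem partA (s : Finset ι)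
    (hs : ∀ i ∈ s, ∀ j ∈ s, P.root i - P.root j ∉ Set.range P.root)
    (hspan : ∀ j, ∃ k : ι → ℤ, (∀ i ∉ s, k i = 0) ∧ E P k = P.root j) :
    ∃ B ⊆ s, ∃ h : N, (∀ b ∈ B, P.toLinearMap (P.root b) h = 1) ∧
      (∀ i, ∃ n : ℤ, n ≠ 0 ∧ P.toLinearMap (P.root i) h = n) ∧
      (∀ i ∈ s, i ∉ B → ∃ n : ℤ, n < 0 ∧ P.toLinearMap (P.root i) h = n) ∧
      ∃ x : ι → ℂ, h = ∑ b ∈ B, x b • P.coroot b := by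
  classical
  -- minimal B
  let T : Set ℕ := {n | ∃ B ⊆ s,
    (∀ j, ∃ k : ι → ℤ, (∀ i ∉ B, k i = 0) ∧ E P k = P.root j) ∧ B.card = n}
  have hT : T.Nonempty := ⟨_, s, subset_rfl, hspan, rfl⟩
  obtain ⟨B, hBs, hBspan, hBcard⟩ := Nat.sInf_mem hT
  have hB : ∀ i ∈ B, ∀ j ∈ B, P.root i - P.root j ∉ Set.range P.root :=
    fun i hi j hj => hs i (hBs hi) j (hBs hj)
  have hind : ∀ k : ι → ℤ, (∀ i ∉ B, k i = 0) → E P k = 0 → k = 0 := by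
    by_contra hdep
    obtain ⟨γ, hγ, l, hl, hlγ, hEl⟩ := exists_dep P B hB hdep
    have hlt : (B.erase γ).card < sInf T := by
      rw [← hBcard]; exact Finset.card_erase_lt_of_mem hγ
    apply Nat.notMem_of_lt_sInf hlt
    refine ⟨_, (Finset.erase_subset _ _).trans hBs, fun j => ?_, rfl⟩
    obtain ⟨k, hk, hE⟩ := hBspan j
    refine ⟨k + k γ • (l - Pi.single γ 1), ?_, ?_⟩
    · intro i hi
      by_cases hiγ : i = γ
      · subst hiγ; simp [hlγ]
      · have : i ∉ B := fun h => hi (Finset.mem_erase.2 ⟨hiγ, h⟩)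
        simp [hk i this, hl i this, hiγ]
    · have h1 : E P (k γ • (l - Pi.single γ 1)) = k γ • E P (l - Pi.single γ 1) := by
        simp only [E, Finset.smul_sum, smul_smul, Pi.smul_apply, smul_eq_mul]
      rw [E_add, h1, E_sub, E_single, hEl, hE]; simp
  obtain ⟨h, hh⟩ := exists_coweight P B hind (fun _ => 1)
  have hval : ∀ k : ι → ℤ, (∀ i ∉ B, k i = 0) → P.toLinearMap (E P k) h = ((∑ i, k i : ℤ) : ℂ) := by
    intro k hk
    simp only [E, map_sum, LinearMap.sum_apply, map_zsmul, LinearMap.smul_apply, Int.cast_sum]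
    refine Finset.sum_congr rfl fun i _ => ?_
    by_cases hi : i ∈ B
    · rw [hh i hi]; simp
    · rw [hk i hi]; simp
  refine ⟨B, hBs, h, hh, ?_, ?_, coroot_span P B hBspan h⟩
  · intro i
    obtain ⟨k, hk, hE⟩ := hBspan i
    refine ⟨∑ i, k i, ?_, by rw [← hE, hval k hk]⟩
    have hk0 : k ≠ 0 := by
      rintro rfl
      apply P.ne_zero i
      rw [← hE]; simp [E]
    intro hsum
    apply hk0
    rcases sign P B hB hind _ k rfl hk ⟨i, hE.symm⟩ with h1 | h1
    · rw [Finset.sum_eq_zero_iff_of_nonneg (fun i _ => h1 i)] at hsum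
      ext i; exact hsum i (Finset.mem_univ _)
    · rw [Finset.sum_eq_zero_iff_of_nonpos (fun i _ => h1 i)] at hsum
      ext i; exact hsum i (Finset.mem_univ _)
  · intro γ hγ hγB
    obtain ⟨k, hk, hE⟩ := hBspan γ
    refine ⟨∑ i, k i, ?_, by rw [← hE, hval k hk]⟩
    obtain ⟨b, hb⟩ := exists_pos_term P k γ hE
    have hkb : k b ≠ 0 := by intro h0; rw [h0] at hb; simp at hb
    have hbB : b ∈ B := by by_contra h0; exact hkb (hk b h0)
    have hob := obtuse P (hs γ hγ b (hBs hbB)) (by rintro rfl; exact hγB hbB)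
    have hkb' : k b < 0 := by by_contra h0; nlinarith
    rcases sign P B hB hind _ k rfl hk ⟨γ, hE.symm⟩ with h1 | h1
    · have := h1 b; omega
    · exact Finset.sum_neg' (fun i _ => h1 i) ⟨b, Finset.mem_univ _, hkb'⟩

end PartA
end PN


namespace PN
open Polynomial in
lemma matrix_line {n l : Type*} [Fintype n] [DecidableEq n] [Fintype l] [DecidableEq l]
    (A0 A1 : Matrix n n ℂ) (p : l → ℂ[X]) (C : l → Matrix n n ℂ)
    (h0 : (Matrix.of fun i j => Matrix.trace (aeval A0 (p i) * C j)).det ≠ 0) :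
    ∃ t : ℂ, (Matrix.of fun i j => Matrix.trace (aeval (A0 + t • (A1 - A0)) (p i) * C j)).det ≠ 0 ∧
      A1.rank ≤ (A0 + t • (A1 - A0)).rank := by
  classical
  -- the universal matrix
  let Au : Matrix n n ℂ[X] := A0.map Polynomial.C + (X : ℂ[X]) • (A1 - A0).map Polynomial.C
  let ev : ℂ → (Matrix n n ℂ[X] →ₐ[ℂ] Matrix n n ℂ) := fun t => (aeval t : ℂ[X] →ₐ[ℂ] ℂ).mapMatrix
  have hAu : ∀ t, ev t Au = A0 + t • (A1 - A0) := by
    intro t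
    ext i j
    simp [Au, ev]
  let D1 : ℂ[X] := (Matrix.of fun i j =>
    Matrix.trace (aeval Au (p i) * (C j).map Polynomial.C)).det
  have hD1 : ∀ t, D1.eval t =
      (Matrix.of fun i j => Matrix.trace (aeval (A0 + t • (A1 - A0)) (p i) * C j)).det := by
    intro t
    have h1 : D1.eval t = (evalRingHom t) D1 := rfl
    rw [h1, RingHom.map_det]
    congr 1
    ext i j
    have h2 : aeval (A0 + t • (A1 - A0)) (p i) * C j =
        ev t (aeval Au (p i) * (C j).map Polynomial.C) := by
      rw [map_mul, ← hAu t, Polynomial.aeval_algHom_apply]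
      congr 1
      ext i j; simp [ev]
    simp only [RingHom.mapMatrix_apply, Matrix.map_apply, Matrix.of_apply, h2]
    simp [Matrix.trace, ev]
  -- the rank
  let f := Matrix.toLin' A1
  obtain ⟨s, hs⟩ := LinearMap.exists_rightInverse_of_surjective f.rangeRestrict
    (LinearMap.range_rangeRestrict f)
  obtain ⟨q, hq⟩ := LinearMap.exists_leftInverse_of_injective (LinearMap.range f).subtype
    (Submodule.ker_subtype _)
  let b := Module.finBasis ℂ (LinearMap.range f)
  let Ym : Matrix n _ ℂ := LinearMap.toMatrix b (Pi.basisFun ℂ n) s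
  let Qm : Matrix _ n ℂ := LinearMap.toMatrix (Pi.basisFun ℂ n) b q
  have hone : Qm * A1 * Ym = 1 := by
    have h3 : A1 = LinearMap.toMatrix (Pi.basisFun ℂ n) (Pi.basisFun ℂ n) f := by
      simp [f]
    rw [h3, ← LinearMap.toMatrix_comp, ← LinearMap.toMatrix_comp]
    have h4 : (q ∘ₗ f) ∘ₗ s = LinearMap.id := by
      ext1 x
      have h5 := LinearMap.congr_fun hs x
      have h6 : f (s x) = (x : n → ℂ) := by
        have := congrArg Subtype.val h5
        simpa using this
      have h7 := LinearMap.congr_fun hq x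
      simp only [LinearMap.comp_apply, h6, LinearMap.id_apply] at h7 ⊢
      exact h7
    rw [h4, LinearMap.toMatrix_id]
  let D2 : ℂ[X] := (Qm.map Polynomial.C * Au * Ym.map Polynomial.C).det
  have hD2 : ∀ t, D2.eval t = (Qm * (A0 + t • (A1 - A0)) * Ym).det := by
    intro t
    have h1 : D2.eval t = (evalRingHom t) D2 := rfl
    rw [h1, RingHom.map_det]
    congr 1
    rw [← hAu t, RingHom.mapMatrix_apply, Matrix.map_mul, Matrix.map_mul]
    congr 1
    · congr 1
      ext i j; simp
    · ext i j; simp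
  have h10 : D1 ≠ 0 := by
    intro h
    apply h0
    have := hD1 0
    rw [h] at this
    simpa using this.symm
  have h20 : D2 ≠ 0 := by
    intro h
    have := hD2 1
    rw [h] at this
    simp [hone] at this
  have hprod : D1 * D2 ≠ 0 := mul_ne_zero h10 h20
  obtain ⟨t, ht⟩ : ∃ t, (D1 * D2).eval t ≠ 0 := by
    by_contra hcon
    push Not at hcon
    exact hprod (Polynomial.funext (by simpa using hcon))
  rw [eval_mul] at ht
  refine ⟨t, ?_, ?_⟩
  · rw [← hD1]; exact left_ne_zero_of_mul ht
  · have h8 : (Qm * (A0 + t • (A1 - A0)) * Ym).det ≠ 0 := by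
      rw [← hD2]; exact right_ne_zero_of_mul ht
    have h9 := Matrix.rank_of_isUnit _ ((Matrix.isUnit_iff_isUnit_det _).2 (isUnit_iff_ne_zero.2 h8))
    rw [Fintype.card_fin] at h9
    calc A1.rank = finrank ℂ (LinearMap.range f) := by
          rw [Matrix.rank]; rfl
      _ = (Qm * (A0 + t • (A1 - A0)) * Ym).rank := h9.symm
      _ ≤ (Qm * (A0 + t • (A1 - A0))).rank := Matrix.rank_mul_le_left _ _
      _ ≤ _ := Matrix.rank_mul_le_right _ _
end PN


namespace PN
section
variable {L : Type*} [LieRing L] [LieAlgebra ℂ L] [FiniteDimensional ℂ L]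
  [LieAlgebra.IsKilling ℂ L]
  (H : LieSubalgebra ℂ L) [H.IsCartanSubalgebra]

/-- A basis of `L` consisting of weight vectors -/
lemma exists_eigenbasis
    (hdecomp : H.toSubmodule ⊔ ⨆ β ∈ rootSet H, eigenSpace H β = ⊤) :
    ∃ (m : ℕ) (v : Basis (Fin m) ℂ L) (w : Fin m → Dual ℂ H), ∀ i,
      v i ∈ eigenSpace H (w i) ∧ (w i = 0 → v i ∈ H) ∧ (w i ≠ 0 → w i ∈ rootSet H) := by
  let S : Set L := (H : Set L) ∪ ⋃ β ∈ rootSet H, (eigenSpace H β : Set L)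
  have hS : ⊤ ≤ Submodule.span ℂ S := by
    rw [← hdecomp]
    refine sup_le ?_ (iSup₂_le fun β hβ => ?_)
    · intro x hx; exact Submodule.subset_span (Or.inl hx)
    · intro x hx
      exact Submodule.subset_span (Or.inr (Set.mem_biUnion hβ hx))
  let b0 := Basis.ofSpan hS
  have : Finite ((linearIndepOn_empty ℂ (id : L → L)).extend (Set.empty_subset S)) :=
    Module.Finite.finite_basis b0
  obtain ⟨m, ⟨e⟩⟩ := Finite.exists_equiv_fin
    ((linearIndepOn_empty ℂ (id : L → L)).extend (Set.empty_subset S))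
  let v := b0.reindex e
  have hv : ∀ i, v i ∈ S := by
    intro i
    apply Basis.ofSpan_subset hS
    simp [v, b0]
  have hw : ∀ i, ∃ w : Dual ℂ H, v i ∈ eigenSpace H w ∧ (w = 0 → v i ∈ H) ∧
      (w ≠ 0 → w ∈ rootSet H) := by
    intro i
    rcases hv i with h | h
    · refine ⟨0, ?_, fun _ => h, fun h => absurd rfl h⟩
      intro y
      have h1 : ⁅y, (⟨v i, h⟩ : H)⁆ = 0 := trivial_lie_zero H H _ _
      have h2 := congrArg Subtype.val h1
      simp only [LinearMap.zero_apply, zero_smul]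
      exact h2
    · obtain ⟨β, hβ, hx⟩ := Set.mem_iUnion₂.1 h
      exact ⟨β, hx, fun h0 => absurd h0 hβ.1, fun _ => hβ⟩
  choose w hw using hw
  exact ⟨m, v, w, hw⟩

variable {m : ℕ} (v : Basis (Fin m) ℂ L) (w : Fin m → Dual ℂ H)
  (hv : ∀ i, v i ∈ eigenSpace H (w i) ∧ (w i = 0 → v i ∈ H) ∧ (w i ≠ 0 → w i ∈ rootSet H))

include hv in
lemma ad_v (h : H) (i : Fin m) : LieAlgebra.ad ℂ L (h : L) (v i) = w i h • v i := (hv i).1 h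

lemma exists_h0 : ∃ h0 : H, ∀ β ∈ insert 0 (Set.range w), ∀ γ ∈ insert 0 (Set.range w),
    β h0 = γ h0 → β = γ := by
  classical
  let T : Set (Dual ℂ H × Dual ℂ H) :=
    {x | x ∈ (insert 0 (Set.range w)) ×ˢ (insert 0 (Set.range w)) ∧ x.1 ≠ x.2}
  have hT : T.Finite := Set.Finite.subset
    (((Set.finite_range w).insert 0).prod ((Set.finite_range w).insert 0)) (fun x hx => hx.1)
  have : Finite T := hT
  obtain ⟨h0, hh⟩ := Module.Dual.exists_forall_ne_zero_of_forall_exists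
    (fun x : T => x.1.1 - x.1.2) (by
      rintro ⟨x, hx⟩
      by_contra hcon
      push Not at hcon
      exact hx.2 (sub_eq_zero.1 (LinearMap.ext hcon)))
  refine ⟨h0, fun β hβ γ hγ heq => ?_⟩
  by_contra hne
  have := hh ⟨(β, γ), ⟨⟨hβ, hγ⟩, hne⟩⟩
  simp [heq] at this

include hv in
lemma exists_poly (h0 : H) (hh : ∀ β ∈ insert 0 (Set.range w), ∀ γ ∈ insert 0 (Set.range w),
    β h0 = γ h0 → β = γ) (c : H) :
    ∃ p : Polynomial ℂ, LieAlgebra.ad ℂ L (c : L) = Polynomial.aeval (LieAlgebra.ad ℂ L (h0 : L)) p := by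
  classical
  refine ⟨Lagrange.interpolate (Finset.univ.image w) (fun β => β h0) (fun β => β c), ?_⟩
  refine v.ext fun i => ?_
  rw [ad_v H v w hv]
  have h1 : (LieAlgebra.ad ℂ L (h0 : L)).HasEigenvector (w i h0) (v i) :=
    ⟨Module.End.mem_eigenspace_iff.2 (ad_v H v w hv h0 i), v.ne_zero i⟩
  rw [Module.End.aeval_apply_of_hasEigenvector h1]
  congr 1
  rw [Lagrange.eval_interpolate_at_node (v := fun β : Dual ℂ H => β h0) _ _ (i := w i)]
  · simp
  · intro β hβ γ hγ h
    simp at hβ hγ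
    exact hh β (Or.inr hβ) γ (Or.inr hγ) h

lemma exists_centralizer (x : L) (p : Polynomial ℂ) :
    ∃ g : L, LieAlgebra.ad ℂ L x g = 0 ∧ ∀ y, killingForm ℂ L g y =
      LinearMap.trace ℂ L (Polynomial.aeval (LieAlgebra.ad ℂ L x) p ∘ₗ LieAlgebra.ad ℂ L y) := by
  have hnd := LieAlgebra.IsKilling.killingForm_nondegenerate ℂ L
  let φ : Dual ℂ L := LinearMap.trace ℂ L ∘ₗ
    (LinearMap.mulLeft ℂ (Polynomial.aeval (LieAlgebra.ad ℂ L x) p)) ∘ₗ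
    (LieAlgebra.ad ℂ L : L →ₗ[ℂ] Module.End ℂ L)
  have hφ : ∀ y, φ y = LinearMap.trace ℂ L
      (Polynomial.aeval (LieAlgebra.ad ℂ L x) p ∘ₗ LieAlgebra.ad ℂ L y) := fun y => rfl
  obtain ⟨g, hg⟩ := (LinearMap.BilinForm.toDual (killingForm ℂ L) hnd).surjective φ
  have hg' : ∀ y, killingForm ℂ L g y = φ y := fun y => by rw [← hg]; rfl
  refine ⟨g, ?_, fun y => by rw [hg', hφ]⟩
  apply hnd.1
  intro y
  have h1 : killingForm ℂ L ⁅x, g⁆ y = - killingForm ℂ L g ⁅x, y⁆ := by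
    rw [← lie_skew, map_neg, LinearMap.neg_apply]
    congr 1
    exact LieModule.traceForm_apply_lie_apply ℂ L L g x y
  have hXY : LieAlgebra.ad ℂ L ⁅x, y⁆ = LieAlgebra.ad ℂ L x * LieAlgebra.ad ℂ L y -
      LieAlgebra.ad ℂ L y * LieAlgebra.ad ℂ L x := by
    ext z; simp
  rw [LieAlgebra.ad_apply, h1, hg', hφ, hXY]
  set X := LieAlgebra.ad ℂ L x
  set Y := LieAlgebra.ad ℂ L y
  set Z := Polynomial.aeval X p with hZ
  have hc : X * Z = Z * X := by
    rw [hZ]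
    exact (Polynomial.commute_X p).map (Polynomial.aeval X) |>.eq |> fun h => by simpa using h
  rw [← Module.End.mul_eq_comp, mul_sub, map_sub,
    ← mul_assoc, ← mul_assoc, ← hc, mul_assoc X, LinearMap.trace_mul_comm, sub_self, neg_zero]

end
end PN


namespace PN
section
variable {L : Type*} [LieRing L] [LieAlgebra ℂ L] [FiniteDimensional ℂ L]
  [LieAlgebra.IsKilling ℂ L]
  (H : LieSubalgebra ℂ L) [H.IsCartanSubalgebra]
variable {m : ℕ} (v : Basis (Fin m) ℂ L) (w : Fin m → Dual ℂ H)
  (hv : ∀ i, v i ∈ eigenSpace H (w i) ∧ (w i = 0 → v i ∈ H) ∧ (w i ≠ 0 → w i ∈ rootSet H))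

include hv in
lemma finrank_H_le_ker (x : L) :
    finrank ℂ H ≤ finrank ℂ (LinearMap.ker (LieAlgebra.ad ℂ L x)) := by
  classical
  obtain ⟨h0, hh⟩ := exists_h0 H w
  let c := Module.finBasis ℂ H
  choose p hp using fun i => exists_poly H v w hv h0 hh (c i)
  let T := LinearMap.toMatrixAlgEquiv v
  have htr : ∀ f g : Module.End ℂ L, LinearMap.trace ℂ L (f ∘ₗ g) = (T f * T g).trace := by
    intro f g
    rw [← map_mul, LinearMap.trace_eq_matrix_trace ℂ v]
    rfl
  have hT : ∀ (x : L) (q : Polynomial ℂ), T (Polynomial.aeval (LieAlgebra.ad ℂ L x) q) =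
      Polynomial.aeval (T (LieAlgebra.ad ℂ L x)) q := by
    intro x q
    exact (Polynomial.aeval_algHom_apply T.toAlgHom _ q).symm
  obtain ⟨t, ht1, ht2⟩ := matrix_line (T (LieAlgebra.ad ℂ L (h0 : L))) (T (LieAlgebra.ad ℂ L x)) p
    (fun j => T (LieAlgebra.ad ℂ L (c j : L))) (by
      have h1 := LieAlgebra.IsKilling.traceForm_cartan_nondegenerate ℂ L H
      rw [LinearMap.BilinForm.nondegenerate_iff_det_ne_zero c] at h1
      convert h1 using 2
      ext i j
      rw [Matrix.of_apply, ← hT, ← htr, ← hp, LinearMap.BilinForm.toMatrix_apply,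
        LieModule.traceForm_apply_apply]
      rfl)
  set xt : L := (h0 : L) + t • (x - h0) with hxt
  have hxt' : T (LieAlgebra.ad ℂ L xt) = T (LieAlgebra.ad ℂ L (h0 : L)) +
      t • (T (LieAlgebra.ad ℂ L x) - T (LieAlgebra.ad ℂ L (h0 : L))) := by
    simp only [hxt, map_add, map_smul, map_sub]
  rw [← hxt'] at ht1 ht2
  choose g hg1 hg2 using fun i => exists_centralizer xt (p i)
  have hgli : LinearIndependent ℂ (fun i => (⟨g i, hg1 i⟩ : LinearMap.ker (LieAlgebra.ad ℂ L xt))) := by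
    rw [Fintype.linearIndependent_iff]
    intro z hz
    have hz' : ∑ i, z i • g i = 0 := by
      have := congrArg Subtype.val hz
      simpa using this
    have := Matrix.eq_zero_of_vecMul_eq_zero ht1 (v := z) (by
      ext j
      have h3 : killingForm ℂ L (∑ i, z i • g i) (c j : L) = 0 := by rw [hz']; simp
      rw [Pi.zero_apply, ← h3]
      simp only [map_sum, map_smul, LinearMap.sum_apply, LinearMap.smul_apply, hg2, htr, hT]
      rfl)
    exact fun i => congrFun this i
  have h4 := hgli.fintype_card_le_finrank
  rw [Fintype.card_fin] at h4
  have hrk : ∀ y : L, (T (LieAlgebra.ad ℂ L y)).rank =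
      finrank ℂ (LinearMap.range (LieAlgebra.ad ℂ L y)) := by
    intro y
    rw [Matrix.rank_eq_finrank_range_toLin _ v v]
    have h7 : Matrix.toLin v v (T (LieAlgebra.ad ℂ L y)) = LieAlgebra.ad ℂ L y :=
      Matrix.toLin_toMatrix v v _
    rw [h7]
  rw [hrk, hrk] at ht2
  have h5 := LinearMap.finrank_range_add_finrank_ker (LieAlgebra.ad ℂ L x)
  have h6 := LinearMap.finrank_range_add_finrank_ker (LieAlgebra.ad ℂ L xt)
  omega

include hv in
lemma repr_ad (h : H) (y : L) (i : Fin m) :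
    v.repr (LieAlgebra.ad ℂ L (h : L) y) i = w i h * v.repr y i := by
  conv_lhs => rw [← v.sum_repr y]
  rw [map_sum]
  simp only [map_smul, ad_v H v w hv]
  simp [Finsupp.single_apply, mul_comm]

include hv in
lemma repr_ad_pow (h : H) (n : ℕ) (y : L) (i : Fin m) :
    v.repr (((LieAlgebra.ad ℂ L (h : L)) ^ n) y) i = (w i h) ^ n * v.repr y i := by
  induction n with
  | zero => simp
  | succ n ih =>
    rw [pow_succ', Module.End.mul_apply, repr_ad H v w hv, ih, pow_succ']; ring

include hv in
lemma rank_eq : LieAlgebra.rank ℂ L = finrank ℂ H := by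
  apply le_antisymm
  · obtain ⟨h0, hh⟩ := exists_h0 H w
    refine (LieAlgebra.rank_le_finrank_engel ℂ (h0 : L)).trans ?_
    apply Submodule.finrank_mono (s := (LieSubalgebra.engel ℂ (h0 : L)).toSubmodule) (t := H.toSubmodule)
    intro y hy
    obtain ⟨n, hn⟩ := (LieSubalgebra.mem_engel_iff ℂ (h0 : L) y).1 hy
    rw [← v.sum_repr y]
    refine Submodule.sum_mem _ fun i _ => ?_
    by_cases hi : w i = 0
    · exact Submodule.smul_mem _ _ ((hv i).2.1 hi)
    · have h1 : w i h0 ≠ 0 := by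
        intro h
        apply hi
        exact hh _ (Or.inr ⟨i, rfl⟩) 0 (Or.inl rfl) (by simpa using h)
      have h2 := repr_ad_pow H v w hv h0 n y i
      rw [hn] at h2
      simp at h2
      rcases h2 with h2 | h2
      · exact absurd h2.1 h1
      · simp [h2]
  · obtain ⟨x, hx⟩ := LieAlgebra.exists_isRegular ℂ L
    rw [← (LieAlgebra.isRegular_iff_finrank_engel_eq_rank ℂ x).1 hx]
    refine (finrank_H_le_ker H v w hv x).trans ?_
    apply Submodule.finrank_mono (t := (LieSubalgebra.engel ℂ x).toSubmodule)
    intro y hy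
    exact (LieSubalgebra.mem_engel_iff ℂ x y).2 ⟨1, by simpa using hy⟩

end
end PN


namespace PN
section
variable {L : Type*} [LieRing L] [LieAlgebra ℂ L] [FiniteDimensional ℂ L]
  [LieAlgebra.IsKilling ℂ L]
  (H : LieSubalgebra ℂ L) [H.IsCartanSubalgebra]
variable {m : ℕ} (v : Basis (Fin m) ℂ L) (w : Fin m → Dual ℂ H)
  (hv : ∀ i, v i ∈ eigenSpace H (w i) ∧ (w i = 0 → v i ∈ H) ∧ (w i ≠ 0 → w i ∈ rootSet H))

lemma rank_lemma (n : Fin m → ℤ) (F G : L →ₗ[ℂ] L)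
    (hF : ∀ i j, v.repr (F (v j)) i ≠ 0 → n i = n j - 1)
    (hG : ∀ i j, v.repr (G (v j)) i ≠ 0 → n j ≤ n i) :
    finrank ℂ (LinearMap.range F) ≤ finrank ℂ (LinearMap.range (F + G)) := by
  classical
  obtain ⟨κ, a, ha, hspan, hli⟩ := exists_linearIndependent' ℂ (fun j => F (v j))
  haveI : Finite κ := Finite.of_injective a ha
  haveI : Fintype κ := Fintype.ofFinite κ
  have hr : LinearMap.range F = Submodule.span ℂ (Set.range ((fun j => F (v j)) ∘ a)) := by
    rw [hspan, LinearMap.range_eq_map, ← v.span_eq, Submodule.map_span, ← Set.range_comp]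
    rfl
  have h1 : finrank ℂ (LinearMap.range F) = Fintype.card κ := by
    rw [hr]; exact finrank_span_eq_card hli
  have h2 : LinearIndependent ℂ (fun k : κ =>
      (⟨(F + G) (v (a k)), LinearMap.mem_range_self _ _⟩ : LinearMap.range (F + G))) := by
    rw [Fintype.linearIndependent_iff]
    intro z hz
    have hz' : ∑ k, z k • (F + G) (v (a k)) = 0 := by
      have := congrArg Subtype.val hz
      simpa using this
    by_contra hcon
    push Not at hcon
    obtain ⟨k1, hk1⟩ := hcon
    obtain ⟨k0, hk0, hmin⟩ := Finset.exists_min_image (Finset.univ.filter (fun k => z k ≠ 0))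
      (fun k => n (a k)) ⟨k1, by simpa using hk1⟩
    have hk0' : z k0 ≠ 0 := by simpa using hk0
    have h3 := Fintype.linearIndependent_iff.1 hli
      (fun k => if n (a k) = n (a k0) then z k else 0) (by
        apply v.ext_elem
        intro i
        simp only [map_sum, map_smul, map_zero, Finsupp.coe_zero, Pi.zero_apply,
          Finsupp.finsetSum_apply, Finsupp.smul_apply, smul_eq_mul, Function.comp]
        by_cases hi : n i = n (a k0) - 1
        · have h4 := congrArg (fun y => v.repr y i) hz'
          simp only [map_sum, map_smul, map_zero, Finsupp.coe_zero, Pi.zero_apply,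
            Finsupp.finsetSum_apply, Finsupp.smul_apply, smul_eq_mul, LinearMap.add_apply,
            map_add, Finsupp.add_apply] at h4
          refine Eq.trans ?_ h4
          refine Finset.sum_congr rfl fun k _ => ?_
          by_cases hzk : z k = 0
          · simp [hzk]
          have h5 := hmin k (by simpa using hzk)
          have h6 : v.repr (G (v (a k))) i = 0 := by
            by_contra h
            have := hG _ _ h
            omega
          rw [h6, add_zero]
          split_ifs with h7
          · rfl
          · have h8 : v.repr (F (v (a k))) i = 0 := by
              by_contra h
              have := hF _ _ h
              omega
            simp [h8]
        · refine Finset.sum_eq_zero fun k _ => ?_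
          split_ifs with h7
          · have h8 : v.repr (F (v (a k))) i = 0 := by
              by_contra h
              have := hF _ _ h
              omega
            simp [h8]
          · simp) k0
    simp at h3
    exact hk0' h3
  rw [h1]
  exact h2.fintype_card_le_finrank

include hv in
lemma grade (h0 : H) (n : Fin m → ℤ) (hn : ∀ i, w i h0 = n i) (x : L) (c : ℂ)
    (hx : ⁅(h0 : L), x⁆ = c • x) (i j : Fin m) (h : v.repr ⁅x, v j⁆ i ≠ 0) :
    (n i : ℂ) = n j + c := by
  have h1 := repr_ad H v w hv h0 ⁅x, v j⁆ i
  have h2 : LieAlgebra.ad ℂ L (h0 : L) (v j) = w j h0 • v j := ad_v H v w hv h0 j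
  rw [LieAlgebra.ad_apply] at h1 h2
  rw [leibniz_lie, hx, h2, smul_lie, lie_smul, ← add_smul, map_smul, Finsupp.smul_apply,
    smul_eq_mul] at h1
  have h3 := mul_right_cancel₀ h h1
  rw [hn, hn] at h3
  rw [← h3]; ring

include hv in
lemma ker_f_neg (h0 : H) (n : Fin m → ℤ) (hn : ∀ i, w i h0 = n i) (e f : L)
    (hf : ⁅(h0 : L), f⁆ = -f) (he : ⁅(h0 : L), e⁆ = e) (hef : ⁅e, f⁆ = (2 : ℂ) • (h0 : L))
    (y : L) (hy : ⁅f, y⁆ = 0) (j : Fin m) (hj : v.repr y j ≠ 0) : n j ≤ 0 := by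
  classical
  by_cases hh : (h0 : L) = 0
  · have : h0 = 0 := Subtype.ext hh
    have h1 := hn j
    rw [this, map_zero] at h1
    have : n j = 0 := by exact_mod_cast h1.symm
    omega
  have t : IsSl2Triple ((2 : ℂ) • (h0 : L)) e f :=
    { h_ne_zero := by simpa using hh
      lie_e_f := hef
      lie_h_e_nsmul := by rw [smul_lie, he, two_smul, two_smul]
      lie_h_f_nsmul := by rw [smul_lie, hf, two_smul, two_smul]; abel }
  set d := n j with hd
  let yd : L := ∑ i, (if n i = d then v.repr y i else 0) • v i
  have hrep : ∀ i, v.repr yd i = if n i = d then v.repr y i else 0 := by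
    intro i
    simp only [yd]
    rw [v.repr_sum_self]
  have h1 : yd ≠ 0 := by
    intro h
    have := hrep j
    rw [h] at this
    simp [hd] at this
    exact hj this.symm
  have h2 : ⁅(h0 : L), yd⁆ = (d : ℂ) • yd := by
    apply v.ext_elem
    intro i
    have := repr_ad H v w hv h0 yd i
    rw [LieAlgebra.ad_apply] at this
    rw [this, map_smul, Finsupp.smul_apply, smul_eq_mul, hrep]
    split_ifs with h
    · rw [hn, h]
    · simp
  have h3 : ⁅f, yd⁆ = 0 := by
    apply v.ext_elem
    intro i
    have h4 := congrArg (fun y => v.repr y i) hy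
    rw [← v.sum_repr y] at h4
    simp only [yd, lie_sum, lie_smul, map_sum, map_smul, map_zero, Finsupp.coe_zero, Pi.zero_apply,
      Finsupp.finsetSum_apply, Finsupp.smul_apply, smul_eq_mul] at h4 ⊢
    have hgr : ∀ k, v.repr ⁅f, v k⁆ i ≠ 0 → n i = n k - 1 := by
      intro k hk
      have := grade H v w hv h0 n hn f (-1) (by rw [hf]; simp) i k hk
      have h5 : (n i : ℂ) = ((n k - 1 : ℤ) : ℂ) := by rw [this]; push_cast; ring
      exact_mod_cast h5
    by_cases hi : n i = d - 1
    · refine Eq.trans ?_ h4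
      refine Finset.sum_congr rfl fun k _ => ?_
      by_cases hk : v.repr ⁅f, v k⁆ i = 0
      · simp [hk]
      · have := hgr k hk
        rw [if_pos (by omega)]
    · refine Finset.sum_eq_zero fun k _ => ?_
      by_cases hk : v.repr ⁅f, v k⁆ i = 0
      · simp [hk]
      · have := hgr k hk
        rw [if_neg (by omega)]
        simp
  have P : t.symm.HasPrimitiveVectorWith yd (-(2 * d : ℂ)) :=
    { ne_zero := h1
      lie_h := by rw [neg_lie, smul_lie, h2, smul_smul, neg_smul]
      lie_e := h3 }
  obtain ⟨N, hN⟩ := P.exists_nat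
  have h6 : (-(2 * d) : ℤ) = (N : ℤ) := by exact_mod_cast hN
  omega

include hv in
lemma killing_zero (h0 : H) (n : Fin m → ℤ) (hn : ∀ i, w i h0 = n i) (i j : Fin m)
    (hij : n i + n j ≠ 0) : killingForm ℂ L (v i) (v j) = 0 := by
  have h1 := LieModule.traceForm_apply_lie_apply ℂ L L (v i) (h0 : L) (v j)
  have h2 : LieAlgebra.ad ℂ L (h0 : L) (v i) = w i h0 • v i := ad_v H v w hv h0 i
  have h3 : LieAlgebra.ad ℂ L (h0 : L) (v j) = w j h0 • v j := ad_v H v w hv h0 j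
  rw [LieAlgebra.ad_apply] at h2 h3
  rw [← lie_skew, h2, h3, hn, hn] at h1
  simp only [map_neg, map_smul, LinearMap.neg_apply, LinearMap.smul_apply, smul_eq_mul] at h1
  have h4 : ((n i + n j : ℤ) : ℂ) * killingForm ℂ L (v i) (v j) = 0 := by
    push_cast
    change -((n i : ℂ) * killingForm ℂ L (v i) (v j)) = (n j : ℂ) * killingForm ℂ L (v i) (v j) at h1
    linear_combination -h1
  rcases mul_eq_zero.1 h4 with h | h
  · exact absurd (by exact_mod_cast h) hij
  · exact h

include hv in
lemma neg_mem_range (h0 : H) (n : Fin m → ℤ) (hn : ∀ i, w i h0 = n i) (e f : L)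
    (hf : ⁅(h0 : L), f⁆ = -f) (he : ⁅(h0 : L), e⁆ = e) (hef : ⁅e, f⁆ = (2 : ℂ) • (h0 : L))
    (i : Fin m) (hi : n i < 0) : v i ∈ LinearMap.range (LieAlgebra.ad ℂ L f) := by
  by_contra hcon
  obtain ⟨φ, hφ1, hφ2⟩ := Submodule.exists_le_ker_of_notMem hcon
  have hnd := LieAlgebra.IsKilling.killingForm_nondegenerate ℂ L
  obtain ⟨y, hy⟩ := ((killingForm ℂ L).toDual hnd).surjective φ
  have hy' : ∀ z, killingForm ℂ L y z = φ z := by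
    intro z; rw [← hy]; rfl
  have h1 : ⁅f, y⁆ = 0 := by
    rw [← lie_skew, neg_eq_zero]
    apply hnd.1
    intro z
    have h2 := LieModule.traceForm_apply_lie_apply ℂ L L y f z
    change killingForm ℂ L ⁅y, f⁆ z = killingForm ℂ L y ⁅f, z⁆ at h2
    rw [h2, hy']
    exact hφ2 (LinearMap.mem_range_self (LieAlgebra.ad ℂ L f) z)
  apply hφ1
  rw [← hy', ← v.sum_repr y]
  simp only [map_sum, map_smul, LinearMap.sum_apply, LinearMap.smul_apply]
  refine Finset.sum_eq_zero fun j _ => ?_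
  by_cases hj : v.repr y j = 0
  · simp [hj]
  · have := ker_f_neg H v w hv h0 n hn e f hf he hef y h1 j hj
    rw [killing_zero H v w hv h0 n hn j i (by omega), smul_zero]

include hv in
lemma ker_le (h0 : H) (n : Fin m → ℤ) (hn : ∀ i, w i h0 = n i) (hn0 : ∀ i, n i = 0 → w i = 0)
    (e f g : L)
    (hf : ⁅(h0 : L), f⁆ = -f) (he : ⁅(h0 : L), e⁆ = e) (hef : ⁅e, f⁆ = (2 : ℂ) • (h0 : L))
    (hg : ∀ i j, v.repr ⁅g, v j⁆ i ≠ 0 → n j ≤ n i) :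
    finrank ℂ (LinearMap.ker (LieAlgebra.ad ℂ L (f + g))) ≤ finrank ℂ H := by
  classical
  have hgr : ∀ i k, v.repr ⁅f, v k⁆ i ≠ 0 → n i = n k - 1 := by
    intro i k hk
    have := grade H v w hv h0 n hn f (-1) (by rw [hf]; simp) i k hk
    have h5 : (n i : ℂ) = ((n k - 1 : ℤ) : ℂ) := by rw [this]; push_cast; ring
    exact_mod_cast h5
  have h1 := rank_lemma v n (LieAlgebra.ad ℂ L f) (LieAlgebra.ad ℂ L g) hgr hg
  have h2 : LinearIndependent ℂ (fun i : {i // n i ≠ 0} =>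
      (⟨if 0 < n i then ⁅f, v i⁆ else v i, by
        split_ifs with h
        · exact LinearMap.mem_range_self (LieAlgebra.ad ℂ L f) _
        · exact neg_mem_range H v w hv h0 n hn e f hf he hef i
            (lt_of_le_of_ne (not_lt.1 h) i.2)⟩ : LinearMap.range (LieAlgebra.ad ℂ L f))) := by
    rw [Fintype.linearIndependent_iff]
    intro z hz
    have hz' : ∑ i : {i // n i ≠ 0}, z i • (if 0 < n i then ⁅f, v i⁆ else v i) = 0 := by
      have := congrArg Subtype.val hz
      simpa using this
    have hneg : ∀ i : {i // n i ≠ 0}, n i < 0 → z i = 0 := by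
      intro i hi
      have h3 := congrArg (fun y => v.repr y i) hz'
      simp only [map_sum, map_smul, map_zero, Finsupp.coe_zero, Pi.zero_apply,
        Finsupp.finsetSum_apply, Finsupp.smul_apply, smul_eq_mul] at h3
      rw [Finset.sum_eq_single i] at h3
      · rw [if_neg (by omega)] at h3
        simpa using h3
      · intro j _ hji
        split_ifs with h
        · have : v.repr ⁅f, v j⁆ i = 0 := by
            by_contra hc
            have := hgr _ _ hc
            omega
          simp [this]
        · have : (j : Fin m) ≠ i := fun h => hji (Subtype.ext h)
          simp [Finsupp.single_apply, this]
      · simp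
    intro i
    rcases lt_or_gt_of_ne i.2 with hi | hi
    · exact hneg i hi
    let y : L := ∑ k : {i // n i ≠ 0}, z k • v k
    have hy : ⁅f, y⁆ = 0 := by
      rw [← hz']
      simp only [y, lie_sum, lie_smul]
      refine Finset.sum_congr rfl fun k _ => ?_
      split_ifs with h
      · rfl
      · rw [hneg k (lt_of_le_of_ne (not_lt.1 h) k.2)]; simp
    have hyi : v.repr y i = z i := by
      simp only [y, map_sum, map_smul, Finsupp.finsetSum_apply, Finsupp.smul_apply, smul_eq_mul]
      rw [Finset.sum_eq_single i]
      · simp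
      · intro j _ hji
        have : (j : Fin m) ≠ i := fun h => hji (Subtype.ext h)
        simp [Finsupp.single_apply, this]
      · simp
    by_contra hc
    have := ker_f_neg H v w hv h0 n hn e f hf he hef y hy i (by rw [hyi]; exact hc)
    omega
  have h3 := h2.fintype_card_le_finrank
  have h4 : LinearIndependent ℂ (fun i : {i // n i = 0} =>
      (⟨v i, (hv i).2.1 (hn0 i i.2)⟩ : H)) := by
    apply LinearIndependent.of_comp H.toSubmodule.subtype
    exact v.linearIndependent.comp (fun i : {i // n i = 0} => (i : Fin m)) Subtype.val_injective
  have h5 := h4.fintype_card_le_finrank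
  have h6 := Fintype.card_subtype_compl (fun i => n i = 0)
  have h7 := Fintype.card_subtype_le (fun i => n i = 0)
  rw [Fintype.card_fin] at h6 h7
  have h8 := LinearMap.finrank_range_add_finrank_ker (LieAlgebra.ad ℂ L (f + g))
  have h9 : finrank ℂ L = m := by rw [finrank_eq_card_basis v, Fintype.card_fin]
  rw [← map_add] at h1
  have h10 : Fintype.card {i // n i ≠ 0} = Fintype.card {i // ¬ n i = 0} := rfl
  omega

end
end PN


namespace PN
section
variable {L : Type*} [LieRing L] [LieAlgebra ℂ L] [FiniteDimensional ℂ L]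
  [LieAlgebra.IsKilling ℂ L]
  (H : LieSubalgebra ℂ L) [H.IsCartanSubalgebra]

open LieAlgebra LieModule LieAlgebra.IsKilling

lemma mem_rootSpace_iff (α : Dual ℂ H) (x : L) : x ∈ rootSpace H α ↔ x ∈ eigenSpace H α := by
  constructor
  · intro hx y
    exact lie_eq_smul_of_mem_rootSpace hx y
  · intro hx
    rw [LieModule.mem_genWeightSpace]
    intro y
    refine ⟨1, ?_⟩
    have := hx y
    simp [this]

lemma mem_rootSet_iff (β : Dual ℂ H) :
    β ∈ rootSet H ↔ β ∈ Set.range (rootSystem H).root := by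
  constructor
  · rintro ⟨h0, h1⟩
    obtain ⟨x, hx, hx0⟩ := Submodule.exists_mem_ne_zero_of_ne_bot h1
    rw [← mem_rootSpace_iff] at hx
    have hne : rootSpace H β ≠ ⊥ := by
      intro h
      rw [h] at hx
      exact hx0 (by simpa using hx)
    let α : Weight ℂ H L := ⟨β, hne⟩
    have hα : α ∈ H.root := by
      simp only [LieSubalgebra.root, Finset.mem_filter, Finset.mem_univ, true_and]
      intro h
      apply h0
      ext y
      exact congrFun h y
    exact ⟨⟨α, hα⟩, by ext y; rfl⟩
  · rintro ⟨α, rfl⟩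
    have hα := H.isNonZero_coe_root α
    refine ⟨(rootSystem H).ne_zero α, ?_⟩
    obtain ⟨x, hx, hx0⟩ := α.1.exists_ne_zero
    intro h
    have : x ∈ eigenSpace H ((rootSystem H).root α) := (mem_rootSpace_iff H _ x).1 hx
    rw [h] at this
    exact hx0 (by simpa using this)

lemma exists_e (b : H.root) (y : L) (hy : y ∈ eigenSpace H (-(rootSystem H).root b)) (hy0 : y ≠ 0) :
    ∃ e ∈ eigenSpace H ((rootSystem H).root b), ⁅e, y⁆ = ((rootSystem H).coroot b : L) := by
  have hb := H.isNonZero_coe_root b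
  obtain ⟨h, e, f, ht, he, hf⟩ := exists_isSl2Triple_of_weight_isNonZero hb
  have hh := ht.h_eq_coroot hb he hf
  have h1 : finrank ℂ (rootSpace H (-b.1 : Weight ℂ H L)) = 1 :=
    finrank_rootSpace_eq_one (-b.1) hb.neg
  have hy' : y ∈ rootSpace H (-b.1 : Weight ℂ H L) := by
    have := (mem_rootSpace_iff H _ y).2 hy
    exact this
  have hf' : f ∈ rootSpace H (-b.1 : Weight ℂ H L) := hf
  generalize rootSpace H (-b.1 : Weight ℂ H L) = S at h1 hy' hf'
  obtain ⟨c, hc⟩ := exists_smul_eq_of_finrank_eq_one h1 (x := ⟨y, hy'⟩)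
    (fun h => hy0 (congrArg Subtype.val h)) ⟨f, hf'⟩
  have hc' : c • y = f := congrArg Subtype.val hc
  have he' : e ∈ eigenSpace H ((rootSystem H).root b) := (mem_rootSpace_iff H _ e).1 he
  refine ⟨c • e, Submodule.smul_mem _ _ he', ?_⟩
  rw [smul_lie, ← lie_smul, hc', ht.lie_e_f, hh, rootSystem_coroot_apply]

lemma lie_mem_eig {α β : Dual ℂ H} {x y : L} (hx : x ∈ eigenSpace H α) (hy : y ∈ eigenSpace H β) :
    ⁅x, y⁆ ∈ eigenSpace H (α + β) := by
  intro z
  have h1 := hx z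
  have h2 := hy z
  rw [LieSubalgebra.coe_bracket_of_module] at h1 h2 ⊢
  rw [leibniz_lie, h1, h2, smul_lie, lie_smul, LinearMap.add_apply, add_smul]

lemma main (Δp Δs : Finset (Module.Dual ℂ H)) (hΔs : Δs ⊆ Δp)
    (hroots : rootSet H = ↑Δp ∪ (fun α => -α) '' ↑Δp)
    (hdecomp : H.toSubmodule ⊔ ⨆ β ∈ rootSet H, eigenSpace H β = ⊤)
    (hsimple : ∀ β ∈ Δp, ∃ k : Module.Dual ℂ H → ℕ, β = ∑ α ∈ Δs, k α • α)
    (hindec : ∀ α ∈ Δs, ¬∃ β ∈ Δp, ∃ γ ∈ Δp, α = β + γ)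
    (eMinus : Module.Dual ℂ H → L)
    (hminus : ∀ α ∈ Δs, eMinus α ∈ eigenSpace H (-α))
    (hne : ∀ α ∈ Δs, eMinus α ≠ 0) :
    finrank ℂ (LinearMap.ker (LieAlgebra.ad ℂ L (∑ α ∈ Δs, eMinus α))) = LieAlgebra.rank ℂ L := by
  classical
  obtain ⟨m, v, w, hv⟩ := exists_eigenbasis H hdecomp
  rw [rank_eq H v w hv]
  refine le_antisymm ?_ (finrank_H_le_ker H v w hv _)
  let P := rootSystem H
  let s : Finset H.root := Finset.univ.filter (fun α => P.root α ∈ Δs)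
  have hsmem : ∀ i, i ∈ s ↔ P.root i ∈ Δs := by intro i; simp [s]
  have hΔroot : ∀ α ∈ Δs, α ∈ Set.range P.root := by
    intro α hα
    rw [← mem_rootSet_iff, hroots]
    exact Or.inl (hΔs hα)
  have himg : Δs = s.image P.root := by
    ext α
    rw [Finset.mem_image]
    constructor
    · intro hα
      obtain ⟨i, rfl⟩ := hΔroot α hα
      exact ⟨i, (hsmem i).2 hα, rfl⟩
    · rintro ⟨i, hi, rfl⟩
      exact (hsmem i).1 hi
  have hs : ∀ i ∈ s, ∀ j ∈ s, P.root i - P.root j ∉ Set.range P.root := by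
    intro i hi j hj h
    rw [← mem_rootSet_iff, hroots] at h
    rw [hsmem] at hi hj
    rcases h with h | ⟨γ, hγ, h⟩
    · exact hindec _ hi ⟨_, hΔs hj, _, h, by abel⟩
    · refine hindec _ hj ⟨_, hΔs hi, γ, hγ, ?_⟩
      have h' : -γ = P.root i - P.root j := h
      rw [← neg_neg γ, h']; abel
  have hsp : ∀ β ∈ Δp, ∃ k : H.root → ℤ, (∀ i ∉ s, k i = 0) ∧ E P k = β := by
    intro β hβ
    obtain ⟨k, hk⟩ := hsimple β hβ
    refine ⟨fun i => if i ∈ s then (k (P.root i) : ℤ) else 0, fun i hi => if_neg hi, ?_⟩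
    have hk2 : β = ∑ i ∈ s, k (P.root i) • P.root i := by
      rw [hk, himg, Finset.sum_image (fun i _ j _ h => P.root.injective h)]
    rw [hk2, E, ← Finset.sum_subset (Finset.subset_univ s)]
    · refine Finset.sum_congr rfl fun i hi => ?_
      rw [if_pos hi, natCast_zsmul]
    · intro i _ hi
      rw [if_neg hi, zero_smul]
  have hspan : ∀ j, ∃ k : H.root → ℤ, (∀ i ∉ s, k i = 0) ∧ E P k = P.root j := by
    intro j
    have hj : P.root j ∈ rootSet H := (mem_rootSet_iff H _).2 ⟨j, rfl⟩
    rw [hroots] at hj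
    rcases hj with hj | ⟨γ, hγ, hj⟩
    · exact hsp _ hj
    · obtain ⟨k, hk1, hk2⟩ := hsp γ hγ
      refine ⟨-k, fun i hi => by simp [hk1 i hi], ?_⟩
      rw [← hj]
      simp only
      rw [← hk2]
      simp [E]
  obtain ⟨B, hBs, h0, hB1, hall, hneg, x, hx⟩ := partA P s hs hspan
  have hB1' : ∀ b ∈ B, P.root b h0 = 1 := hB1
  have hall' : ∀ i, ∃ n : ℤ, n ≠ 0 ∧ P.root i h0 = n := hall
  have hneg' : ∀ i ∈ s, i ∉ B → ∃ n : ℤ, n < 0 ∧ P.root i h0 = n := hneg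
  have hw : ∀ i, ∃ n : ℤ, w i h0 = n ∧ (n = 0 → w i = 0) := by
    intro i
    by_cases hi : w i = 0
    · exact ⟨0, by simp [hi], fun _ => hi⟩
    · obtain ⟨j, hj⟩ := (mem_rootSet_iff H _).1 ((hv i).2.2 hi)
      obtain ⟨n, hn, hn2⟩ := hall' j
      refine ⟨n, ?_, fun h => absurd h hn⟩
      rw [← hj]; exact hn2
  choose n hn hn0 using hw
  have hem : ∀ i ∈ s, eMinus (P.root i) ∈ eigenSpace H (-P.root i) :=
    fun i hi => hminus _ ((hsmem i).1 hi)
  have hee : ∀ b : H.root, ∃ e : L, b ∈ s → e ∈ eigenSpace H (P.root b) ∧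
      ⁅e, eMinus (P.root b)⁆ = (P.coroot b : L) := by
    intro b
    by_cases hb : b ∈ s
    · obtain ⟨e, h1, h2⟩ := exists_e H b _ (hem b hb) (hne _ ((hsmem b).1 hb))
      exact ⟨e, fun _ => ⟨h1, h2⟩⟩
    · exact ⟨0, fun h => absurd h hb⟩
  choose eb heb using hee
  have hlie0 : ∀ b ∈ s, ∀ b' ∈ s, b ≠ b' → ⁅eb b, eMinus (P.root b')⁆ = 0 := by
    intro b hb b' hb' hbb
    have h1 := lie_mem_eig H (heb b hb).1 (hem b' hb')
    rw [← sub_eq_add_neg] at h1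
    by_contra hc
    apply hs b hb b' hb'
    rw [← mem_rootSet_iff]
    refine ⟨fun h => hbb (P.root.injective (sub_eq_zero.1 h)), fun h => ?_⟩
    rw [h] at h1
    exact hc (by simpa using h1)
  have hadm : ∀ i ∈ s, ⁅(h0 : L), eMinus (P.root i)⁆ = (-(P.root i h0)) • eMinus (P.root i) :=
    fun i hi => hem i hi h0
  have hadp : ∀ i ∈ s, ⁅(h0 : L), eb i⁆ = (P.root i h0) • eb i :=
    fun i hi => (heb i hi).1 h0
  have hξ : ∑ α ∈ Δs, eMinus α =
      ∑ b ∈ B, eMinus (P.root b) + ∑ b ∈ s \ B, eMinus (P.root b) := by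
    rw [himg, Finset.sum_image (fun i _ j _ h => P.root.injective h), add_comm,
      Finset.sum_sdiff hBs]
  rw [hξ]
  refine ker_le H v w hv h0 n hn hn0 (∑ b ∈ B, (2 * x b) • eb b) _ _ ?_ ?_ ?_ ?_
  · rw [lie_sum, ← Finset.sum_neg_distrib]
    refine Finset.sum_congr rfl fun b hb => ?_
    rw [hadm b (hBs hb), hB1' b hb, neg_smul, one_smul]
  · rw [lie_sum]
    refine Finset.sum_congr rfl fun b hb => ?_
    rw [lie_smul, hadp b (hBs hb), hB1' b hb, one_smul]
  · rw [sum_lie]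
    have h1 : ((h0 : H) : L) = ∑ b ∈ B, x b • (P.coroot b : L) := by
      conv_lhs => rw [hx]
      simp
    rw [h1, Finset.smul_sum]
    refine Finset.sum_congr rfl fun b hb => ?_
    rw [lie_sum, Finset.sum_eq_single b]
    · rw [smul_lie, (heb b (hBs hb)).2, smul_smul]
    · intro b' hb' hbb
      rw [smul_lie, hlie0 b (hBs hb) b' (hBs hb') (Ne.symm hbb), smul_zero]
    · intro h; exact absurd hb h
  · intro i j hij
    rw [sum_lie, map_sum, Finsupp.finsetSum_apply] at hij
    obtain ⟨c, hc, hc2⟩ := Finset.exists_ne_zero_of_sum_ne_zero hij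
    rw [Finset.mem_sdiff] at hc
    have h1 := grade H v w hv h0 n hn _ _ (hadm c hc.1) i j hc2
    obtain ⟨N, hN, hN2⟩ := hneg' c hc.1 hc.2
    rw [hN2] at h1
    have h2 : n i = n j + -N := by exact_mod_cast h1
    omega

end
end PN

/-- The principal nilpotent element `ξ := Σ_{α ∈ Π} e₋_α`, the sum over the
simple roots (denoted `Δs` below) of chosen nonzero root vectors `e₋_α ∈ 𝔤_{-α}`, is a regular
element of the finite-dimensional complex semisimple Lie algebra `𝔤` of rank `r`:
`dim ker (ad ξ) = r`.  Here `Δ₊` (denoted `Δp`) is a choice of positive roots, so that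
`Δ = Δ₊ ⊔ (-Δ₊)`, and `Π ⊆ Δ₊` is the set of simple roots: every positive root is a
non-negative integer combination of elements of `Π`, and no element of `Π` is a sum of two
positive roots. -/
theorem principal_nilpotent_isRegular
    {L : Type*} [LieRing L] [LieAlgebra ℂ L] [FiniteDimensional ℂ L]
    [LieAlgebra.IsSemisimple ℂ L]
    (r : ℕ) (hr : LieAlgebra.rank ℂ L = r)
    (H : LieSubalgebra ℂ L) (hH : H.IsCartanSubalgebra)
    (Δp Δs : Finset (Module.Dual ℂ H)) (hΔs : Δs ⊆ Δp)
    (hpos : ↑Δp ⊆ rootSet H)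
    (hroots : rootSet H = ↑Δp ∪ (fun α => -α) '' ↑Δp)
    (hdisj : ∀ β ∈ Δp, -β ∉ Δp)
    (hdecomp : H.toSubmodule ⊔ ⨆ β ∈ rootSet H, eigenSpace H β = ⊤)
    (hsimple : ∀ β ∈ Δp, ∃ k : Module.Dual ℂ H → ℕ, β = ∑ α ∈ Δs, k α • α)
    (hindec : ∀ α ∈ Δs, ¬∃ β ∈ Δp, ∃ γ ∈ Δp, α = β + γ)
    (eMinus : Module.Dual ℂ H → L)
    (hminus : ∀ α ∈ Δs, eMinus α ∈ eigenSpace H (-α))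
    (hne : ∀ α ∈ Δs, eMinus α ≠ 0) :
    finrank ℂ (LinearMap.ker (LieAlgebra.ad ℂ L (∑ α ∈ Δs, eMinus α))) = r := by
  haveI := hH
  rw [← hr]
  exact PN.main H Δp Δs hΔs hroots hdecomp hsimple hindec eMinus hminus hne
end
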